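/- arXiv:2507.12121 — 3 statements merged into one kernel-verified Lean document; each statement's English description precedes it below -/
import Mathlib

section
/- Let n ≥ 1 and let π = ℤ/nℤ be the cyclic group of order n. Then dim_ℂ 𝒜_Θ^odd(ℂπ) equals p₃(n), the number of partitions of n into at most three parts; explicitly, dim_ℂ 𝒜_Θ^odd(ℂπ) = (1/12)n² + (1/2)n + 1 if n ≡ 0 mod 2 and n ≡ 0 mod 3; = (1/12)n² + (1/2)n + 2/3 if n ≡ 0 mod 2 and n ≢ 0 mod 3; = (1/12)n² + (1/2)n + 3/4 if n ≢ 0 mod 2 and n ≡ 0 mod 3; = (1/12)n² + (1/2)n + 5/12 if n ≢ 0 mod 2 and n ≢ 0 mod 3. -/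
/-!
Theta-invariant dimensions for spherical 3-manifold groups (Kodani–Watanabe).

For a group `π`, the space `𝒜_Θ^odd(ℂπ)` is the space of `ℤ/2`-invariant elements of the
coinvariant space `(Sym³ ℂπ)_{π×π}`, where `π × π` acts on `ℂπ` by `(g,h)·x = g x h⁻¹` and the
`ℤ/2`-action is induced by the involution `x ↦ x⁻¹` applied in each factor.  Identifying
`(ℂπ)^{⊗3}` with the space of functions `π³ → ℂ`, its dimension equals the dimension of the
space of functions `π³ → ℂ` that are invariant under permutations of the three coordinates,
under the simultaneous two-sided action `(x,y,z) ↦ (gxh⁻¹, gyh⁻¹, gzh⁻¹)`, and under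
coordinatewise inversion.  (For a finite group this set of functions is already a linear
subspace, so taking its span does not change it.)
-/

/-- The dimension `dim_ℂ 𝒜_Θ^odd(ℂπ)`. -/
noncomputable def dimAThetaOddGroupAlgebra (G : Type*) [Group G] : ℕ :=
  Module.finrank ℂ ↥(Submodule.span ℂ
    { f : G × G × G → ℂ |
      (∀ x y z : G, f (y, x, z) = f (x, y, z)) ∧
      (∀ x y z : G, f (x, z, y) = f (x, y, z)) ∧
      (∀ g h x y z : G, f (g * x * h⁻¹, g * y * h⁻¹, g * z * h⁻¹) = f (x, y, z)) ∧
      (∀ x y z : G, f (x⁻¹, y⁻¹, z⁻¹) = f (x, y, z)) })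

/-- `p₃ m`: the number of integer solutions of `x + y + z = m` with `0 ≤ x ≤ y ≤ z`
(automatically `0` for `m < 0`). -/
noncomputable def p3 (m : ℤ) : ℕ :=
  Nat.card {t : ℤ × ℤ × ℤ // 0 ≤ t.1 ∧ t.1 ≤ t.2.1 ∧ t.2.1 ≤ t.2.2 ∧ t.1 + t.2.1 + t.2.2 = m}

/-- The index set counted by `p3`. -/
abbrev P3 (m : ℤ) : Type :=
  {t : ℤ × ℤ × ℤ // 0 ≤ t.1 ∧ t.1 ≤ t.2.1 ∧ t.2.1 ≤ t.2.2 ∧ t.1 + t.2.1 + t.2.2 = m}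

instance P3.finite (m : ℤ) : Finite (P3 m) := by
  refine Set.Finite.to_subtype
    (((Set.finite_Icc (0 : ℤ) m).prod ((Set.finite_Icc 0 m).prod (Set.finite_Icc 0 m))).subset ?_)
  rintro ⟨a, b, c⟩ h
  change 0 ≤ a ∧ a ≤ b ∧ b ≤ c ∧ a + b + c = m at h
  simp only [Set.mem_prod, Set.mem_Icc]
  omega

/-- Solutions with positive smallest part shift down to solutions for `m - 3`; those with
smallest part `0` are determined by the middle part. -/
def P3.equivSum (m : ℕ) : P3 m ≃ P3 ((m : ℤ) - 3) ⊕ Fin (m / 2 + 1) where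
  toFun t :=
    if h : 1 ≤ t.1.1 then
      .inl ⟨(t.1.1 - 1, t.1.2.1 - 1, t.1.2.2 - 1), by have := t.2; grind⟩
    else .inr ⟨t.1.2.1.toNat, by have := t.2; grind⟩
  invFun := Sum.elim
    (fun t => ⟨(t.1.1 + 1, t.1.2.1 + 1, t.1.2.2 + 1), by have := t.2; grind⟩)
    (fun i => ⟨(0, i, m - i), by have := i.2; grind⟩)
  left_inv := by
    rintro ⟨⟨a, b, c⟩, h⟩
    simp only at h
    by_cases h1 : 1 ≤ a
    · simp [h1]
    · simp only [h1, dite_false, Sum.elim_inr, Subtype.mk.injEq, Prod.mk.injEq]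
      omega
  right_inv := by
    rintro (⟨⟨a, b, c⟩, h⟩ | i)
    · simp only at h
      simp [h.1]
    · simp

theorem p3_eq_add (m : ℕ) : p3 m = p3 ((m : ℤ) - 3) + (m / 2 + 1) := by
  have := Nat.card_congr (P3.equivSum m)
  rwa [Nat.card_sum, Nat.card_fin] at this

theorem p3_of_neg {m : ℤ} (hm : m < 0) : p3 m = 0 := by
  have : IsEmpty (P3 m) := ⟨fun t => by have := t.2; omega⟩
  exact Nat.card_of_isEmpty (α := P3 m)

theorem twelve_mul_p3 (m : ℕ) : 12 * p3 m = m ^ 2 + 6 * m +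
    if m % 2 = 0 then if m % 3 = 0 then 12 else 8 else if m % 3 = 0 then 9 else 5 := by
  induction m using Nat.strong_induction_on with
  | _ m ih =>
    rw [p3_eq_add]
    rcases lt_or_ge m 3 with h | h
    · rw [p3_of_neg (by omega)]
      interval_cases m <;> rfl
    · obtain ⟨k, rfl⟩ := Nat.exists_eq_add_of_le' h
      have hk := ih k (by omega)
      have hc : ((k + 3 : ℕ) : ℤ) - 3 = k := by push_cast; ring
      have hsq : (k + 3) ^ 2 = k ^ 2 + 6 * k + 9 := by ring
      rw [hc, hsq]
      split_ifs at hk ⊢ <;> omega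

/-- The theta-invariant functions on `G × G × G`. -/
def thetaInvariant (G : Type*) [Group G] : Submodule ℂ (G × G × G → ℂ) where
  carrier := { f : G × G × G → ℂ |
      (∀ x y z : G, f (y, x, z) = f (x, y, z)) ∧
      (∀ x y z : G, f (x, z, y) = f (x, y, z)) ∧
      (∀ g h x y z : G, f (g * x * h⁻¹, g * y * h⁻¹, g * z * h⁻¹) = f (x, y, z)) ∧
      (∀ x y z : G, f (x⁻¹, y⁻¹, z⁻¹) = f (x, y, z)) }
  add_mem' := by
    rintro f g ⟨h1, h2, h3, h4⟩ ⟨k1, k2, k3, k4⟩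
    exact ⟨fun x y z => congrArg₂ (· + ·) (h1 x y z) (k1 x y z),
      fun x y z => congrArg₂ (· + ·) (h2 x y z) (k2 x y z),
      fun g h x y z => congrArg₂ (· + ·) (h3 g h x y z) (k3 g h x y z),
      fun x y z => congrArg₂ (· + ·) (h4 x y z) (k4 x y z)⟩
  zero_mem' := ⟨fun _ _ _ => rfl, fun _ _ _ => rfl, fun _ _ _ _ _ => rfl, fun _ _ _ => rfl⟩
  smul_mem' := by
    rintro c f ⟨h1, h2, h3, h4⟩
    exact ⟨fun x y z => congrArg (c * ·) (h1 x y z),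
      fun x y z => congrArg (c * ·) (h2 x y z),
      fun g h x y z => congrArg (c * ·) (h3 g h x y z),
      fun x y z => congrArg (c * ·) (h4 x y z)⟩

theorem dimAThetaOddGroupAlgebra_eq_finrank (G : Type*) [Group G] :
    dimAThetaOddGroupAlgebra G = Module.finrank ℂ (thetaInvariant G) :=
  congrArg (fun S : Submodule ℂ (G × G × G → ℂ) => Module.finrank ℂ S)
    (thetaInvariant G).span_eq

section Cyclic

variable {n : ℕ}

/-- The triple of points on the `n`-cycle whose first two consecutive gaps are `a` and `b`. -/
def gapTriple (n : ℕ) (a b : ℤ) :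
    Multiplicative (ZMod n) × Multiplicative (ZMod n) × Multiplicative (ZMod n) :=
  (.ofAdd 0, .ofAdd (a : ZMod n), .ofAdd ((a + b : ℤ) : ZMod n))

theorem thetaInvariant.apply_add {f} (hf : f ∈ thetaInvariant (Multiplicative (ZMod n)))
    (g x y z : ZMod n) :
    f (.ofAdd (g + x), .ofAdd (g + y), .ofAdd (g + z)) = f (.ofAdd x, .ofAdd y, .ofAdd z) := by
  simpa using hf.2.2.1 (.ofAdd g) 1 (.ofAdd x) (.ofAdd y) (.ofAdd z)

theorem thetaInvariant.apply_gapTriple_swap {f}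
    (hf : f ∈ thetaInvariant (Multiplicative (ZMod n))) (a b : ℤ) :
    f (gapTriple n b a) = f (gapTriple n a b) := by
  obtain ⟨h1, h2, -, h4⟩ := id hf
  have h := apply_add hf ((a + b : ℤ) : ZMod n) (-0) (-(a : ZMod n)) (-((a + b : ℤ) : ZMod n))
  have e : ((a + b : ℤ) : ZMod n) + -(a : ZMod n) = b := by push_cast; ring
  rw [neg_zero, add_zero, e, add_neg_cancel] at h
  have h' := h4 (.ofAdd 0) (.ofAdd (a : ZMod n)) (.ofAdd ((a + b : ℤ) : ZMod n))
  simp only [← ofAdd_neg, neg_zero] at h'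
  rw [gapTriple, gapTriple, ← h', ← h, add_comm b a, h1, ← h2, h1, h2]

theorem thetaInvariant.apply_gapTriple_rotate {f}
    (hf : f ∈ thetaInvariant (Multiplicative (ZMod n))) {a b c : ℤ} (h : a + b + c = n) :
    f (gapTriple n b c) = f (gapTriple n a b) := by
  obtain ⟨h1, h2, -, -⟩ := id hf
  have k := apply_add hf (a : ZMod n) 0 (b : ZMod n) ((b + c : ℤ) : ZMod n)
  have e : (a : ZMod n) + ((b + c : ℤ) : ZMod n) = 0 := by
    have := congrArg (Int.cast : ℤ → ZMod n) h
    push_cast at this ⊢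
    rw [← add_assoc, this, ZMod.natCast_self]
  rw [e, add_zero, ← Int.cast_add] at k
  rw [gapTriple, gapTriple, ← k, Int.cast_add]
  exact (h2 _ _ _).symm.trans (h1 _ _ _)

/-- Evaluation of a theta-invariant function on the sorted gap triples. -/
def thetaInvariant.restrict (n : ℕ) :
    thetaInvariant (Multiplicative (ZMod n)) →ₗ[ℂ] (P3 n → ℂ) :=
  (LinearMap.funLeft ℂ ℂ fun p : P3 n => gapTriple n p.1.1 p.1.2.1) ∘ₗ Submodule.subtype _

theorem thetaInvariant.apply_gapTriple_eq_zero {f}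
    (hf : f ∈ thetaInvariant (Multiplicative (ZMod n)))
    (h0 : ∀ p : P3 n, f (gapTriple n p.1.1 p.1.2.1) = 0) {a b c : ℤ}
    (ha : 0 ≤ a) (hb : 0 ≤ b) (hc : 0 ≤ c) (h : a + b + c = n) :
    f (gapTriple n a b) = 0 := by
  have key : ∀ x y z : ℤ, 0 ≤ x → x ≤ y → y ≤ z → x + y + z = n → f (gapTriple n x y) = 0 :=
    fun x y z h1 h2 h3 h4 => h0 ⟨(x, y, z), h1, h2, h3, h4⟩
  have r1 := apply_gapTriple_rotate hf h
  have r2 := apply_gapTriple_rotate hf (a := b) (b := c) (c := a) (by omega)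
  have s1 := apply_gapTriple_swap hf a b
  have s2 := apply_gapTriple_swap hf b c
  have s3 := apply_gapTriple_swap hf c a
  rcases le_total a b with hab | hab <;> rcases le_total b c with hbc | hbc <;>
    rcases le_total a c with hac | hac
  · exact key a b c ha hab hbc h
  · exact key a b c ha hab hbc h
  · rw [← r1, ← r2, ← s3]; exact key a c b ha hac hbc (by omega)
  · rw [← r1, ← r2]; exact key c a b hc hac hab (by omega)
  · rw [← s1]; exact key b a c hb hab hac (by omega)
  · rw [← r1]; exact key b c a hb hbc hac (by omega)
  · rw [← r1, ← s2]; exact key c b a hc hbc hab (by omega)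
  · rw [← r1, ← s2]; exact key c b a hc hbc hab (by omega)

theorem thetaInvariant.restrict_injective [NeZero n] :
    Function.Injective (restrict n) := by
  rw [← LinearMap.ker_eq_bot, LinearMap.ker_eq_bot']
  rintro ⟨f, hf⟩ h0
  have h0' : ∀ p : P3 n, f (gapTriple n p.1.1 p.1.2.1) = 0 := fun p => congrFun h0 p
  have ordered : ∀ u v : ZMod n, u.val ≤ v.val → f (.ofAdd 0, .ofAdd u, .ofAdd v) = 0 := by
    intro u v huv
    have hv := v.val_lt
    have := apply_gapTriple_eq_zero hf h0' (a := u.val) (b := v.val - u.val) (c := n - v.val)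
      (by omega) (by omega) (by omega) (by omega)
    simpa [gapTriple] using this
  ext ⟨x, y, z⟩
  have h := apply_add hf x.toAdd 0 (y.toAdd - x.toAdd) (z.toAdd - x.toAdd)
  simp only [add_zero, add_sub_cancel, ofAdd_toAdd] at h
  change f (x, y, z) = 0
  rw [h]
  rcases le_total (y.toAdd - x.toAdd).val (z.toAdd - x.toAdd).val with hle | hle
  · exact ordered _ _ hle
  · rw [hf.2.1]
    exact ordered _ _ hle

/-- The multiset of pairwise distances on the `n`-cycle. -/
def cyclicDistances
    (t : Multiplicative (ZMod n) × Multiplicative (ZMod n) × Multiplicative (ZMod n)) :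
    Multiset ℕ :=
  {(t.1.toAdd - t.2.1.toAdd).valMinAbs.natAbs, (t.2.1.toAdd - t.2.2.toAdd).valMinAbs.natAbs,
    (t.1.toAdd - t.2.2.toAdd).valMinAbs.natAbs}

theorem natAbs_valMinAbs_sub_comm (x y : ZMod n) :
    (x - y).valMinAbs.natAbs = (y - x).valMinAbs.natAbs := by
  rw [← neg_sub, ZMod.natAbs_valMinAbs_neg]

theorem comp_cyclicDistances_mem (F : Multiset ℕ → ℂ) :
    F ∘ cyclicDistances ∈ thetaInvariant (Multiplicative (ZMod n)) := by
  refine ⟨fun x y z => ?_, fun x y z => ?_, fun g h x y z => ?_, fun x y z => ?_⟩ <;>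
    refine congrArg F ?_ <;> simp only [cyclicDistances]
  · rw [natAbs_valMinAbs_sub_comm y.toAdd x.toAdd]
    simp only [Multiset.insert_eq_cons]
    rw [← Multiset.singleton_add, ← Multiset.singleton_add, ← Multiset.singleton_add,
      ← Multiset.singleton_add, add_comm {(x.toAdd - z.toAdd).valMinAbs.natAbs}]
  · rw [natAbs_valMinAbs_sub_comm z.toAdd y.toAdd]
    simp only [Multiset.insert_eq_cons, ← Multiset.singleton_add]
    ac_rfl
  · simp [toAdd_mul, toAdd_inv, add_sub_add_right_eq_sub, add_sub_add_left_eq_sub]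
  · simp only [toAdd_inv, ← neg_sub', ZMod.natAbs_valMinAbs_neg]

theorem natAbs_valMinAbs_intCast [NeZero n] {a : ℤ} (ha : 0 ≤ a) (han : 2 * a ≤ n) :
    (a : ZMod n).valMinAbs.natAbs = a.toNat := by
  have := NeZero.pos n
  rw [(ZMod.valMinAbs_spec (a : ZMod n) a).2 ⟨rfl, by omega, by omega⟩]
  omega

theorem cyclicDistances_gapTriple [NeZero n] (p : P3 n) :
    cyclicDistances (gapTriple n p.1.1 p.1.2.1) =
      {p.1.1.toNat, p.1.2.1.toNat, min p.1.2.2.toNat (p.1.1 + p.1.2.1).toNat} := by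
  obtain ⟨⟨a, b, c⟩, h⟩ := p
  simp only at h ⊢
  have e1 : (0 - (a : ZMod n)).valMinAbs.natAbs = a.toNat := by
    rw [zero_sub, ZMod.natAbs_valMinAbs_neg, natAbs_valMinAbs_intCast (by omega) (by omega)]
  have e2 : ((a : ZMod n) - ((a + b : ℤ) : ZMod n)).valMinAbs.natAbs = b.toNat := by
    rw [natAbs_valMinAbs_sub_comm, Int.cast_add, add_sub_cancel_left,
      natAbs_valMinAbs_intCast (by omega) (by omega)]
  have e3 : (0 - ((a + b : ℤ) : ZMod n)).valMinAbs.natAbs = min c.toNat (a + b).toNat := by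
    rcases le_total c (a + b) with hc | hc
    · have : (0 - ((a + b : ℤ) : ZMod n)) = (c : ℤ) := by
        rw [sub_eq_iff_eq_add, ← Int.cast_add, add_comm c, h.2.2.2, Int.cast_natCast,
          ZMod.natCast_self]
      rw [this, natAbs_valMinAbs_intCast (by omega) (by omega)]
      omega
    · rw [zero_sub, ZMod.natAbs_valMinAbs_neg, natAbs_valMinAbs_intCast (by omega) (by omega)]
      omega
  simp only [cyclicDistances, gapTriple, toAdd_ofAdd, e1, e2, e3]

theorem cyclicDistances_gapTriple_injective [NeZero n] :
    Function.Injective fun p : P3 n => cyclicDistances (gapTriple n p.1.1 p.1.2.1) := by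
  intro p q h
  simp only [cyclicDistances_gapTriple] at h
  obtain ⟨⟨a, b, c⟩, hp⟩ := p
  obtain ⟨⟨a', b', c'⟩, hq⟩ := q
  simp only at h hp hq
  have hs : ∀ x y z : ℕ, x ≤ y → y ≤ z → Multiset.sort ({x, y, z} : Multiset ℕ) = [x, y, z] := by
    intro x y z h1 h2
    refine (List.mergeSort_eq_self (· ≤ ·) ?_)
    simp [h1, h2, h1.trans h2]
  have := congrArg Multiset.sort h
  rw [hs _ _ _ (by omega) (by omega), hs _ _ _ (by omega) (by omega)] at this
  simp only [List.cons.injEq] at this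
  simp only [Subtype.mk.injEq, Prod.mk.injEq]
  omega

theorem thetaInvariant.restrict_surjective [NeZero n] :
    Function.Surjective (restrict n) := by
  intro g
  refine ⟨⟨_, comp_cyclicDistances_mem (Function.extend
    (fun p : P3 n => cyclicDistances (gapTriple n p.1.1 p.1.2.1)) g 0)⟩, ?_⟩
  ext p
  exact cyclicDistances_gapTriple_injective.extend_apply g 0 p

theorem dimAThetaOddGroupAlgebra_cyclic_eq_p3 [NeZero n] :
    dimAThetaOddGroupAlgebra (Multiplicative (ZMod n)) = p3 n := by
  have := Fintype.ofFinite (P3 n)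
  rw [dimAThetaOddGroupAlgebra_eq_finrank,
    (LinearEquiv.ofBijective (thetaInvariant.restrict n)
      ⟨thetaInvariant.restrict_injective, thetaInvariant.restrict_surjective⟩).finrank_eq,
    Module.finrank_fintype_fun_eq_card, ← Nat.card_eq_fintype_card]
  rfl

end Cyclic

/-- for `π = ℤ/nℤ` (`n ≥ 1`), `dim 𝒜_Θ^odd(ℂπ) = p₃(n)`, with the explicit
formulas according to the residues of `n` mod 2 and mod 3. -/
theorem dim_aThetaOdd_groupAlgebra_cyclic (n : ℕ) (hn : 1 ≤ n) :
    dimAThetaOddGroupAlgebra (Multiplicative (ZMod n)) = p3 (n : ℤ) ∧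
    (n % 2 = 0 → n % 3 = 0 →
      (dimAThetaOddGroupAlgebra (Multiplicative (ZMod n)) : ℚ)
        = (1/12) * n^2 + (1/2) * n + 1) ∧
    (n % 2 = 0 → n % 3 ≠ 0 →
      (dimAThetaOddGroupAlgebra (Multiplicative (ZMod n)) : ℚ)
        = (1/12) * n^2 + (1/2) * n + 2/3) ∧
    (n % 2 ≠ 0 → n % 3 = 0 →
      (dimAThetaOddGroupAlgebra (Multiplicative (ZMod n)) : ℚ)
        = (1/12) * n^2 + (1/2) * n + 3/4) ∧
    (n % 2 ≠ 0 → n % 3 ≠ 0 →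
      (dimAThetaOddGroupAlgebra (Multiplicative (ZMod n)) : ℚ)
        = (1/12) * n^2 + (1/2) * n + 5/12) := by
  have : NeZero n := ⟨by omega⟩
  have h := twelve_mul_p3 n
  rw [dimAThetaOddGroupAlgebra_cyclic_eq_p3]
  refine ⟨rfl, fun h2 h3 => ?_, fun h2 h3 => ?_, fun h2 h3 => ?_, fun h2 h3 => ?_⟩ <;>
    simp only [h2, h3, if_true, if_false] at h <;>
    have h' := congrArg (Nat.cast : ℕ → ℚ) h <;>
    push_cast at h' <;>
    linarith
end

section
/- Let n ≥ 1 and let π = ℤ/nℤ be the cyclic group of order n. Then dim_ℂ 𝒜_Θ^odd(Ker ε) equals p₃(n−3), the number of partitions of n−3 into at most three parts (with p₃(m) = 0 for m < 0); explicitly, dim_ℂ 𝒜_Θ^odd(Ker ε) = (1/12)n² if n ≡ 0 mod 2 and n ≡ 0 mod 3; = (1/12)n² − 1/3 if n ≡ 0 mod 2 and n ≢ 0 mod 3; = (1/12)n² + 1/4 if n ≢ 0 mod 2 and n ≡ 0 mod 3; = (1/12)n² − 1/12 if n ≢ 0 mod 2 and n ≢ 0 mod 3. -/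
/-!
Statement 1: `dim 𝒜_Θ^odd(Ker ε)` for the cyclic group `ℤ/nℤ`.

Identifying `(ℂπ)^{⊗3}` with functions `π³ → ℂ`, the subspace
`(Ker ε)^{⊗3}` consists of the functions whose sum over each single coordinate
(the other two being fixed) vanishes.  Thus `dim 𝒜_Θ^odd(Ker ε)` is the dimension of the
space of functions `π³ → ℂ` with vanishing marginal sums that are invariant under
permutations of the coordinates, the two-sided action `(x,y,z) ↦ (gxh⁻¹,gyh⁻¹,gzh⁻¹)`
and coordinatewise inversion.
-/

open scoped BigOperators

/-- The dimension `dim_ℂ 𝒜_Θ^odd(Ker ε)`. -/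
noncomputable def dimAThetaOddKerAug (G : Type*) [Group G] : ℕ :=
  Module.finrank ℂ ↥(Submodule.span ℂ
    { f : G × G × G → ℂ |
      (∀ x y z : G, f (y, x, z) = f (x, y, z)) ∧
      (∀ x y z : G, f (x, z, y) = f (x, y, z)) ∧
      (∀ g h x y z : G, f (g * x * h⁻¹, g * y * h⁻¹, g * z * h⁻¹) = f (x, y, z)) ∧
      (∀ x y z : G, f (x⁻¹, y⁻¹, z⁻¹) = f (x, y, z)) ∧
      (∀ y z : G, ∑ᶠ x : G, f (x, y, z) = 0) ∧
      (∀ x z : G, ∑ᶠ y : G, f (x, y, z) = 0) ∧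
      (∀ x y : G, ∑ᶠ z : G, f (x, y, z) = 0) })

/-- Functions on `G³` that are symmetric in their arguments and invariant under two-sided
translation and under inversion. -/
structure IsInvariantTriple {G : Type*} [Group G] (f : G × G × G → ℂ) : Prop where
  swap_left : ∀ x y z, f (y, x, z) = f (x, y, z)
  swap_right : ∀ x y z, f (x, z, y) = f (x, y, z)
  translate : ∀ g h x y z, f (g * x * h⁻¹, g * y * h⁻¹, g * z * h⁻¹) = f (x, y, z)
  inv : ∀ x y z, f (x⁻¹, y⁻¹, z⁻¹) = f (x, y, z)

/-- The invariant functions on `G³` whose marginal sums vanish. -/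
def kerAugInvariants (G : Type*) [Group G] [Fintype G] : Submodule ℂ (G × G × G → ℂ) where
  carrier := {f | IsInvariantTriple f ∧ ∀ x y, ∑ z, f (x, y, z) = 0}
  zero_mem' := ⟨by constructor <;> simp, by simp⟩
  add_mem' := by
    rintro f f' ⟨hf, hs⟩ ⟨hf', hs'⟩
    refine ⟨⟨?_, ?_, ?_, ?_⟩, fun x y => ?_⟩
    · intro x y z; simp [hf.swap_left x y z, hf'.swap_left x y z]
    · intro x y z; simp [hf.swap_right x y z, hf'.swap_right x y z]
    · intro g h x y z; simp [hf.translate g h x y z, hf'.translate g h x y z]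
    · intro x y z; simp [hf.inv x y z, hf'.inv x y z]
    · simp [Finset.sum_add_distrib, hs, hs']
  smul_mem' := by
    rintro c f ⟨hf, hs⟩
    refine ⟨⟨?_, ?_, ?_, ?_⟩, fun x y => ?_⟩
    · intro x y z; simp [hf.swap_left x y z]
    · intro x y z; simp [hf.swap_right x y z]
    · intro g h x y z; simp [hf.translate g h x y z]
    · intro x y z; simp [hf.inv x y z]
    · simp [← Finset.mul_sum, hs]

theorem dimAThetaOddKerAug_eq_finrank (G : Type*) [Group G] [Fintype G] :
    dimAThetaOddKerAug G = Module.finrank ℂ (kerAugInvariants G) := by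
  unfold dimAThetaOddKerAug
  rw [Submodule.span_eq_of_le (kerAugInvariants G)]
  · rintro f ⟨h₁, h₂, h₃, h₄, -, -, hs⟩
    exact ⟨⟨h₁, h₂, h₃, h₄⟩, fun x y => by rw [← finsum_eq_sum_of_fintype, hs]⟩
  · rintro f ⟨h, hs⟩
    refine Submodule.subset_span ⟨h.swap_left, h.swap_right, h.translate, h.inv,
      fun y z => ?_, fun x z => ?_, fun x y => ?_⟩
    · rw [finsum_eq_sum_of_fintype, ← hs y z]
      exact Finset.sum_congr rfl fun x _ => by rw [h.swap_right y x z, h.swap_left x y z]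
    · rw [finsum_eq_sum_of_fintype, ← hs x z]
      exact Finset.sum_congr rfl fun y _ => (h.swap_right x y z).symm
    · rw [finsum_eq_sum_of_fintype, hs]

section Completion

variable {G : Type*} [Fintype G]

open Classical in
/-- Modifies a function on `G³` that vanishes on degenerate triples, changing it only at the
degenerate triples, so that its marginal sums vanish. -/
noncomputable def degenerateCompletion (h : G × G × G → ℂ) (p : G × G × G) : ℂ :=
  h p - 1 / 2 * ((if p.1 = p.2.1 then ∑ t, h (p.1, p.2.2, t) else 0)
      + (if p.2.1 = p.2.2 then ∑ t, h (p.1, p.2.1, t) else 0)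
      + (if p.1 = p.2.2 then ∑ t, h (p.1, p.2.1, t) else 0))
    + 1 / 2 * (if p.1 = p.2.1 ∧ p.2.1 = p.2.2 then ∑ s, ∑ t, h (p.1, s, t) else 0)

theorem degenerateCompletion_of_ne (h : G × G × G → ℂ) {x y z : G} (hxy : x ≠ y) (hyz : y ≠ z)
    (hxz : x ≠ z) : degenerateCompletion h (x, y, z) = h (x, y, z) := by
  simp [degenerateCompletion, hxy, hyz, hxz]

theorem degenerateCompletion_equiv (h : G × G × G → ℂ) (σ : G ≃ G)
    (hσ : ∀ x y z, h (σ x, σ y, σ z) = h (x, y, z)) (x y z : G) :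
    degenerateCompletion h (σ x, σ y, σ z) = degenerateCompletion h (x, y, z) := by
  classical
  have h₁ (a b : G) : ∑ t, h (σ a, σ b, t) = ∑ t, h (a, b, t) := by
    rw [← Equiv.sum_comp σ]
    simp [hσ]
  have h₂ (a : G) : ∑ s, ∑ t, h (σ a, s, t) = ∑ s, ∑ t, h (a, s, t) := by
    rw [← Equiv.sum_comp σ]
    simp [h₁]
  simp only [degenerateCompletion, hσ, h₁, h₂, σ.injective.eq_iff]

theorem degenerateCompletion_swap_left (h : G × G × G → ℂ)
    (hl : ∀ x y z, h (y, x, z) = h (x, y, z)) (x y z : G) :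
    degenerateCompletion h (y, x, z) = degenerateCompletion h (x, y, z) := by
  have hs (a b : G) : ∑ t, h (b, a, t) = ∑ t, h (a, b, t) := by simp [hl a b]
  by_cases hxy : x = y
  · rw [hxy]
  · simp [degenerateCompletion, hl x y z, hxy, Ne.symm hxy, hs x y, add_comm]

theorem degenerateCompletion_swap_right (h : G × G × G → ℂ)
    (hl : ∀ x y z, h (y, x, z) = h (x, y, z)) (hr : ∀ x y z, h (x, z, y) = h (x, y, z))
    (x y z : G) :
    degenerateCompletion h (x, z, y) = degenerateCompletion h (x, y, z) := by
  have hs (a b : G) : ∑ t, h (b, a, t) = ∑ t, h (a, b, t) := by simp [hl a b]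
  by_cases hyz : y = z
  · rw [hyz]
  · by_cases hxy : x = y
    · subst hxy
      simp [degenerateCompletion, hr x x z, hyz, Ne.symm hyz]
    · by_cases hxz : x = z
      · subst hxz
        simp [degenerateCompletion, hr x y x, hyz, Ne.symm hyz]
      · simp [degenerateCompletion, hr x y z, hyz, Ne.symm hyz, hxy, hxz]

theorem sum_degenerateCompletion (h : G × G × G → ℂ)
    (hd : ∀ x z, h (x, x, z) = 0) (x y : G) :
    ∑ z, degenerateCompletion h (x, y, z) = 0 := by
  classical
  simp only [degenerateCompletion, Finset.sum_add_distrib, Finset.sum_sub_distrib,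
    ← Finset.mul_sum]
  by_cases hxy : x = y
  · subst hxy
    simp [hd]
  · simp [hxy]
    ring

theorem degenerateCompletion_mem [Group G] {h : G × G × G → ℂ} (hh : IsInvariantTriple h)
    (hd : ∀ x z, h (x, x, z) = 0) : degenerateCompletion h ∈ kerAugInvariants G :=
  ⟨⟨degenerateCompletion_swap_left h hh.swap_left,
    degenerateCompletion_swap_right h hh.swap_left hh.swap_right,
    fun g k => degenerateCompletion_equiv h ((Equiv.mulLeft g).trans (Equiv.mulRight k⁻¹))
      (hh.translate g k),
    degenerateCompletion_equiv h (Equiv.inv G) hh.inv⟩,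
    sum_degenerateCompletion h hd⟩

theorem eq_zero_of_mem_kerAugInvariants [Group G] {f : G × G × G → ℂ}
    (hf : f ∈ kerAugInvariants G)
    (h₀ : ∀ x y z, x ≠ y → y ≠ z → x ≠ z → f (x, y, z) = 0) : f = 0 := by
  classical
  obtain ⟨hi, hs⟩ := hf
  have hc (x y : G) : f (y, y, x) = f (x, x, y) := by
    have hy := hi.translate y⁻¹ 1 y y x
    have hx := hi.translate x⁻¹ 1 x x y
    have hinv := hi.inv 1 1 (x⁻¹ * y)
    simp only [inv_mul_cancel, inv_one, mul_one, mul_inv_rev, inv_inv] at hx hy hinv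
    rw [← hx, ← hy, hinv]
  have h₁ (x y : G) (hxy : x ≠ y) : f (x, x, y) = 0 := by
    have hsum := hs x y
    rw [Fintype.sum_eq_add x y hxy fun z hz => h₀ x y z hxy hz.2.symm hz.1.symm,
      hi.swap_right x x y, hi.swap_left y x y, hi.swap_right y y x, hc x y] at hsum
    exact self_eq_neg.mp (eq_neg_of_add_eq_zero_left hsum)
  have h₂ (x : G) : f (x, x, x) = 0 := by
    rw [← hs x x, Fintype.sum_eq_single x fun y hy => h₁ x y hy.symm]
  funext ⟨x, y, z⟩
  have h₃ (x y : G) : f (x, x, y) = 0 := by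
    by_cases hxy : x = y
    · rw [← hxy, h₂]
    · exact h₁ x y hxy
  by_cases hxy : x = y
  · rw [hxy, h₃, Pi.zero_apply]
  by_cases hxz : x = z
  · rw [hxz, hi.swap_right, h₃, Pi.zero_apply]
  by_cases hyz : y = z
  · rw [hyz, hi.swap_left, hi.swap_right, h₃, Pi.zero_apply]
  exact h₀ x y z hxy hyz hxz

end Completion

section Cyclic

variable {n : ℕ} [NeZero n]

/-- The residue in `[0, n)` of the step from `x` to `y` in the cyclic group. -/
def cyclicGap (x y : Multiplicative (ZMod n)) : ℕ := (x⁻¹ * y).toAdd.val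

theorem cyclicGap_lt (x y : Multiplicative (ZMod n)) : cyclicGap x y < n := ZMod.val_lt _

omit [NeZero n] in
theorem cyclicGap_eq_zero {x y : Multiplicative (ZMod n)} : cyclicGap x y = 0 ↔ x = y := by
  simp [cyclicGap, ZMod.val_eq_zero, neg_add_eq_zero]

omit [NeZero n] in
theorem cyclicGap_inv (x y : Multiplicative (ZMod n)) : cyclicGap x⁻¹ y⁻¹ = cyclicGap y x := by
  simp [cyclicGap, add_comm]

theorem cyclicGap_swap {x y : Multiplicative (ZMod n)} (h : x ≠ y) :
    cyclicGap y x = n - cyclicGap x y := by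
  have hne : (x⁻¹ * y).toAdd ≠ 0 := fun h₀ => h (cyclicGap_eq_zero.mp (by simp [cyclicGap, h₀]))
  have heq : (y⁻¹ * x).toAdd = -(x⁻¹ * y).toAdd := by simp [add_comm]
  rw [cyclicGap, heq, ZMod.neg_val, if_neg hne, cyclicGap]

theorem cyclicGap_sum {x y : Multiplicative (ZMod n)} (hxy : x ≠ y)
    (z : Multiplicative (ZMod n)) :
    cyclicGap x y + cyclicGap y z + cyclicGap z x = n ∨
      cyclicGap x y + cyclicGap y z + cyclicGap z x = 2 * n := by
  have hdvd : n ∣ cyclicGap x y + cyclicGap y z + cyclicGap z x := by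
    rw [← ZMod.natCast_eq_zero_iff]
    simp [cyclicGap]
  obtain ⟨k, hk⟩ := hdvd
  have h₁ := cyclicGap_lt x y
  have h₂ := cyclicGap_lt y z
  have h₃ := cyclicGap_lt z x
  have h₄ := cyclicGap_eq_zero.not.mpr hxy
  have hlo : 0 < k := by
    rcases Nat.eq_zero_or_pos k with rfl | h
    · omega
    · exact h
  have hhi : k < 3 := by
    by_contra! h
    have := Nat.mul_le_mul_left n h
    omega
  interval_cases k <;> omega

/-- The two smallest parts, in increasing order, of the partition of `n` given by the gaps
`u, v, w` (adding up to `n`) or by their complements (if they add up to `2 * n`). -/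
def gapKey (n u v w : ℕ) : ℕ × ℕ :=
  if u + v + w = n then
    (min u (min v w), n - min u (min v w) - max u (max v w))
  else (n - max u (max v w), max u (max v w) + min u (min v w) - n)

/-- The two smallest parts of the partitions of `n` into three positive parts. -/
def gapIndex (n : ℕ) : Finset (ℕ × ℕ) :=
  {p ∈ Finset.range (n + 1) ×ˢ Finset.range (n + 1) | 1 ≤ p.1 ∧ p.1 ≤ p.2 ∧ p.1 + 2 * p.2 ≤ n}

theorem mem_gapIndex {n : ℕ} {p : ℕ × ℕ} :
    p ∈ gapIndex n ↔ 1 ≤ p.1 ∧ p.1 ≤ p.2 ∧ p.1 + 2 * p.2 ≤ n := by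
  simp only [gapIndex, Finset.mem_filter, Finset.mem_product, Finset.mem_range]
  omega

/-- The function of a triple in the cyclic group that is zero on degenerate triples and otherwise
applies `g` to the unordered partition of `n` given by its gaps. -/
def gapFunction (n : ℕ) (g : ℕ × ℕ → ℂ)
    (p : Multiplicative (ZMod n) × Multiplicative (ZMod n) × Multiplicative (ZMod n)) : ℂ :=
  if p.1 = p.2.1 ∨ p.2.1 = p.2.2 ∨ p.1 = p.2.2 then 0
  else g (gapKey n (cyclicGap p.1 p.2.1) (cyclicGap p.2.1 p.2.2) (cyclicGap p.2.2 p.1))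

omit [NeZero n] in
theorem gapFunction_of_ne (g : ℕ × ℕ → ℂ) {x y z : Multiplicative (ZMod n)} (hxy : x ≠ y)
    (hyz : y ≠ z) (hxz : x ≠ z) :
    gapFunction n g (x, y, z) = g (gapKey n (cyclicGap x y) (cyclicGap y z) (cyclicGap z x)) := by
  simp [gapFunction, hxy, hyz, hxz]

theorem gapKey_swap {n u v w : ℕ} (hu : u < n) (hv : v < n) (hw : w < n)
    (h : u + v + w = n ∨ u + v + w = 2 * n) :
    gapKey n (n - u) (n - w) (n - v) = gapKey n u v w := by
  have hmin : min (n - u) (min (n - w) (n - v)) = n - max u (max v w) := by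
    rw [Nat.sub_min_sub_left, Nat.sub_min_sub_left, max_comm w v]
  have hmax : max (n - u) (max (n - w) (n - v)) = n - min u (min v w) := by
    rw [Nat.sub_max_sub_left, Nat.sub_max_sub_left, min_comm w v]
  have hle : min u (min v w) ≤ max u (max v w) := (min_le_left _ _).trans (le_max_left _ _)
  have hlt : max u (max v w) < n := max_lt hu (max_lt hv hw)
  unfold gapKey
  rw [hmin, hmax]
  clear hmin hmax
  generalize min u (min v w) = a at *
  generalize max u (max v w) = b at *
  rcases h with h | h
  · rw [if_neg (by omega), if_pos h]
    ext <;> (simp only; omega)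
  · rw [if_pos (by omega), if_neg (by omega)]
    ext <;> simp only
    omega

theorem gapKey_comm (n u v w : ℕ) : gapKey n u w v = gapKey n u v w := by
  rw [gapKey, gapKey, add_right_comm, min_comm w v, max_comm w v]

theorem gapKey_rotate (n u v w : ℕ) : gapKey n v w u = gapKey n u v w := by
  unfold gapKey
  split_ifs <;> simp only [Prod.mk.injEq] <;> omega

theorem gapFunction_swap_left (g : ℕ × ℕ → ℂ) (x y z : Multiplicative (ZMod n)) :
    gapFunction n g (y, x, z) = gapFunction n g (x, y, z) := by
  by_cases h : x = y ∨ y = z ∨ x = z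
  · simp only [gapFunction]
    rw [if_pos (by tauto), if_pos h]
  · push Not at h
    obtain ⟨hxy, hyz, hxz⟩ := h
    rw [gapFunction_of_ne g hxy.symm hxz hyz, gapFunction_of_ne g hxy hyz hxz,
      cyclicGap_swap hxy, cyclicGap_swap hyz, cyclicGap_swap hxz.symm,
      gapKey_swap (cyclicGap_lt _ _) (cyclicGap_lt _ _) (cyclicGap_lt _ _)
        (cyclicGap_sum hxy z)]

omit [NeZero n] in
theorem gapFunction_rotate (g : ℕ × ℕ → ℂ) (x y z : Multiplicative (ZMod n)) :
    gapFunction n g (y, z, x) = gapFunction n g (x, y, z) := by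
  by_cases h : x = y ∨ y = z ∨ x = z
  · simp only [gapFunction]
    rw [if_pos (by tauto), if_pos h]
  · push Not at h
    obtain ⟨hxy, hyz, hxz⟩ := h
    rw [gapFunction_of_ne g hyz hxz.symm hxy.symm, gapFunction_of_ne g hxy hyz hxz, gapKey_rotate]

theorem isInvariantTriple_gapFunction (g : ℕ × ℕ → ℂ) : IsInvariantTriple (gapFunction n g) where
  swap_left := gapFunction_swap_left g
  swap_right x y z := by
    rw [← gapFunction_swap_left, gapFunction_rotate, gapFunction_rotate]
  translate a b x y z := by
    have hgap (x y : Multiplicative (ZMod n)) :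
        cyclicGap (a * x * b⁻¹) (a * y * b⁻¹) = cyclicGap x y := by
      rw [cyclicGap, cyclicGap]
      congr 2
      rw [mul_right_comm a x, mul_right_comm a y, mul_inv_rev, mul_assoc, inv_mul_cancel_left]
    simp [gapFunction, hgap]
  inv x y z := by
    rw [← gapFunction_swap_left]
    simp only [gapFunction, cyclicGap_inv, inv_inj, gapKey_comm n (cyclicGap x y) (cyclicGap y z)]
    congr 1
    rw [eq_comm (a := x) (b := y), or_comm (a := y = z)]

theorem eq_gap_representative {f : _ → ℂ} (hf : IsInvariantTriple f)
    (x y z : Multiplicative (ZMod n)) :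
    f (x, y, z) = f (1, .ofAdd (cyclicGap x y : ZMod n),
      .ofAdd (cyclicGap x y + cyclicGap y z : ZMod n)) := by
  rw [← hf.translate x⁻¹ 1 x y z]
  have hcast (a b : Multiplicative (ZMod n)) : (cyclicGap a b : ZMod n) = (a⁻¹ * b).toAdd :=
    ZMod.natCast_zmod_val _
  rw [hcast, hcast, ← toAdd_mul, ofAdd_toAdd, ofAdd_toAdd]
  simp

theorem eq_zero_of_gap_representatives {f : _ → ℂ} (hf : IsInvariantTriple f)
    (h₀ : ∀ p ∈ gapIndex n, f (1, .ofAdd (p.1 : ZMod n), .ofAdd (p.1 + p.2 : ZMod n)) = 0)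
    {x y z : Multiplicative (ZMod n)} (hxy : x ≠ y) (hyz : y ≠ z) (hxz : x ≠ z) :
    f (x, y, z) = 0 := by
  have hmin (x y z : Multiplicative (ZMod n)) (hxy : x ≠ y)
      (hsum : cyclicGap x y + cyclicGap y z + cyclicGap z x = n)
      (hv : cyclicGap x y ≤ cyclicGap y z) (hw : cyclicGap x y ≤ cyclicGap z x) :
      f (x, y, z) = 0 := by
    have hpos := cyclicGap_eq_zero.not.mpr hxy
    rcases le_total (cyclicGap y z) (cyclicGap z x) with h | h
    · rw [eq_gap_representative hf]
      exact h₀ (cyclicGap x y, cyclicGap y z) (mem_gapIndex.mpr (by omega))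
    · rw [← hf.swap_left, ← hf.inv, eq_gap_representative hf, cyclicGap_inv, cyclicGap_inv]
      exact h₀ (cyclicGap x y, cyclicGap z x) (mem_gapIndex.mpr (by omega))
  have hpart (x y z : Multiplicative (ZMod n)) (hxy : x ≠ y) (hyz : y ≠ z) (hxz : x ≠ z)
      (hsum : cyclicGap x y + cyclicGap y z + cyclicGap z x = n) : f (x, y, z) = 0 := by
    by_cases h₁ : cyclicGap x y ≤ cyclicGap y z ∧ cyclicGap x y ≤ cyclicGap z x
    · exact hmin x y z hxy hsum h₁.1 h₁.2
    by_cases h₂ : cyclicGap y z ≤ cyclicGap z x ∧ cyclicGap y z ≤ cyclicGap x y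
    · rw [← hf.swap_left, ← hf.swap_right]
      exact hmin y z x hyz (by omega) h₂.1 h₂.2
    · rw [← hf.swap_right, ← hf.swap_left]
      exact hmin z x y hxz.symm (by omega) (by omega) (by omega)
  rcases cyclicGap_sum hxy z with h | h
  · exact hpart x y z hxy hyz hxz h
  · rw [← hf.swap_left]
    refine hpart y x z hxy.symm hxz hyz ?_
    rw [cyclicGap_swap hxy, cyclicGap_swap hyz, cyclicGap_swap hxz.symm]
    have := cyclicGap_lt x y
    have := cyclicGap_lt y z
    have := cyclicGap_lt z x
    omega

theorem gapFunction_representative (g : ℕ × ℕ → ℂ) {p : ℕ × ℕ} (hp : p ∈ gapIndex n) :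
    degenerateCompletion (gapFunction n g)
      (1, .ofAdd (p.1 : ZMod n), .ofAdd (p.1 + p.2 : ZMod n)) = g p := by
  obtain ⟨h₁, h₂, h₃⟩ := mem_gapIndex.mp hp
  have hxy : cyclicGap 1 (.ofAdd (p.1 : ZMod n)) = p.1 := by
    simpa [cyclicGap] using ZMod.val_cast_of_lt (by omega)
  have hyz : cyclicGap (.ofAdd (p.1 : ZMod n)) (.ofAdd (p.1 + p.2 : ZMod n)) = p.2 := by
    simpa [cyclicGap] using ZMod.val_cast_of_lt (by omega)
  have hxz : cyclicGap 1 (.ofAdd (p.1 + p.2 : ZMod n)) = p.1 + p.2 := by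
    have := ZMod.val_cast_of_lt (n := n) (a := p.1 + p.2) (by omega)
    simpa [cyclicGap] using this
  have hxy' := cyclicGap_eq_zero.not.mp (hxy.trans_ne (by omega))
  have hyz' := cyclicGap_eq_zero.not.mp (hyz.trans_ne (by omega))
  have hxz' := cyclicGap_eq_zero.not.mp (hxz.trans_ne (by omega))
  rw [degenerateCompletion_of_ne _ hxy' hyz' hxz', gapFunction_of_ne g hxy' hyz' hxz',
    cyclicGap_swap hxz', hxy, hyz, hxz]
  congr 1
  unfold gapKey
  rw [if_pos (by omega)]
  ext <;> simp only <;> omega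

variable (n) in
/-- Evaluation of an invariant function at one triple for each partition of `n`. -/
def evalGapRepresentatives :
    kerAugInvariants (Multiplicative (ZMod n)) →ₗ[ℂ] (gapIndex n → ℂ) where
  toFun f p := f.1 (1, .ofAdd (p.1.1 : ZMod n), .ofAdd (p.1.1 + p.1.2 : ZMod n))
  map_add' _ _ := rfl
  map_smul' _ _ := rfl

theorem bijective_evalGapRepresentatives : Function.Bijective (evalGapRepresentatives n) := by
  constructor
  · rw [← LinearMap.ker_eq_bot, LinearMap.ker_eq_bot']
    intro f hf
    refine Subtype.ext (eq_zero_of_mem_kerAugInvariants f.2 fun x y z => ?_)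
    exact eq_zero_of_gap_representatives f.2.1 fun p hp => congrFun hf ⟨p, hp⟩
  · intro g
    refine ⟨⟨_, degenerateCompletion_mem
      (isInvariantTriple_gapFunction (Function.extend Subtype.val g 0))
      fun x z => by simp [gapFunction]⟩, funext fun p => ?_⟩
    exact (gapFunction_representative _ p.2).trans (Subtype.val_injective.extend_apply g 0 p)

end Cyclic

theorem dimAThetaOddKerAug_cyclic_eq_card (n : ℕ) [NeZero n] :
    dimAThetaOddKerAug (Multiplicative (ZMod n)) = (gapIndex n).card := by
  rw [dimAThetaOddKerAug_eq_finrank,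
    (LinearEquiv.ofBijective _ bijective_evalGapRepresentatives).finrank_eq,
    Module.finrank_fintype_fun_eq_card, Fintype.card_coe]

theorem p3_sub_three_eq_card (n : ℕ) : p3 ((n : ℤ) - 3) = (gapIndex n).card := by
  let e : {t : ℤ × ℤ × ℤ // 0 ≤ t.1 ∧ t.1 ≤ t.2.1 ∧ t.2.1 ≤ t.2.2 ∧
      t.1 + t.2.1 + t.2.2 = (n : ℤ) - 3} ≃ gapIndex n :=
    { toFun t := ⟨((t.1.1 + 1).toNat, (t.1.2.1 + 1).toNat), mem_gapIndex.mpr (by grind)⟩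
      invFun p := ⟨(p.1.1 - 1, p.1.2 - 1, n - p.1.1 - p.1.2 - 1), by
        have := mem_gapIndex.mp p.2
        grind⟩
      left_inv t := by ext <;> grind
      right_inv p := by
        have := mem_gapIndex.mp p.2
        ext <;> grind }
  rw [p3, Nat.card_congr e, Nat.card_eq_fintype_card, Fintype.card_coe]

theorem card_gapIndex_add_three (n : ℕ) :
    (gapIndex (n + 3)).card = (gapIndex n).card + (n + 2) / 2 := by
  let shift : ℕ × ℕ ↪ ℕ × ℕ := (addRightEmbedding 1).prodMap (addRightEmbedding 1)
  let first : ℕ ↪ ℕ × ℕ := ⟨(1, ·), Prod.mk_right_injective 1⟩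
  have hsplit : gapIndex (n + 3) =
      (gapIndex n).map shift ∪ (Finset.Icc 1 ((n + 2) / 2)).map first := by
    ext ⟨a, b⟩
    simp only [Finset.mem_union, Finset.mem_map, mem_gapIndex, Finset.mem_Icc]
    constructor
    · rintro ⟨h₁, h₂, h₃⟩
      by_cases ha : a = 1
      · exact .inr ⟨b, by grind, by simp [first, ha]⟩
      · exact .inl ⟨(a - 1, b - 1), by grind, by simp [shift]; omega⟩
    · rintro (⟨⟨a', b'⟩, h, heq⟩ | ⟨b', h, heq⟩)
      · simp only [shift, Function.Embedding.coe_prodMap, Prod.map_apply, addRightEmbedding_apply,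
          Prod.mk.injEq] at heq
        grind
      · simp only [first, Function.Embedding.coeFn_mk, Prod.mk.injEq] at heq
        grind
  rw [hsplit, Finset.card_union_of_disjoint, Finset.card_map, Finset.card_map, Nat.card_Icc,
    Nat.add_sub_cancel]
  simp only [Finset.disjoint_left, Finset.mem_map, not_exists, not_and]
  rintro _ ⟨⟨a, b⟩, h, rfl⟩ c - heq
  have := (mem_gapIndex.mp h).1
  simp only [shift, first, Function.Embedding.coe_prodMap, Prod.map_apply,
    addRightEmbedding_apply, Function.Embedding.coeFn_mk, Prod.mk.injEq] at heq
  omega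

theorem card_gapIndex (n : ℕ) : (gapIndex n).card = (n ^ 2 + 6) / 12 := by
  induction n using Nat.strong_induction_on with
  | _ n ih =>
    match n with
    | 0 => rfl
    | 1 => rfl
    | 2 => rfl
    | n + 3 =>
      rw [card_gapIndex_add_three, ih n (by omega)]
      obtain ⟨k, r, hr, rfl⟩ : ∃ k r, r < 6 ∧ n = 6 * k + r :=
        ⟨n / 6, n % 6, Nat.mod_lt _ (by norm_num), (Nat.div_add_mod n 6).symm⟩
      have h₁ : (6 * k + r) ^ 2 = 36 * k ^ 2 + 12 * (r * k) + r ^ 2 := by ring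
      have h₂ : (6 * k + r + 3) ^ 2 =
          36 * k ^ 2 + 12 * (r * k) + 36 * k + r ^ 2 + 6 * r + 9 := by ring
      rw [h₁, h₂]
      generalize k ^ 2 = m
      interval_cases r <;> omega

/-- for `π = ℤ/nℤ` (`n ≥ 1`), `dim 𝒜_Θ^odd(Ker ε) = p₃(n − 3)`, with the explicit
formulas according to the residues of `n` mod 2 and mod 3. -/
theorem dim_aThetaOdd_kerAug_cyclic (n : ℕ) (hn : 1 ≤ n) :
    dimAThetaOddKerAug (Multiplicative (ZMod n)) = p3 ((n : ℤ) - 3) ∧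
    (n % 2 = 0 → n % 3 = 0 →
      (dimAThetaOddKerAug (Multiplicative (ZMod n)) : ℚ) = (1/12) * n^2) ∧
    (n % 2 = 0 → n % 3 ≠ 0 →
      (dimAThetaOddKerAug (Multiplicative (ZMod n)) : ℚ) = (1/12) * n^2 - 1/3) ∧
    (n % 2 ≠ 0 → n % 3 = 0 →
      (dimAThetaOddKerAug (Multiplicative (ZMod n)) : ℚ) = (1/12) * n^2 + 1/4) ∧
    (n % 2 ≠ 0 → n % 3 ≠ 0 →
      (dimAThetaOddKerAug (Multiplicative (ZMod n)) : ℚ) = (1/12) * n^2 - 1/12) := by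
  have : NeZero n := ⟨by omega⟩
  have hcard := (dimAThetaOddKerAug_cyclic_eq_card n).trans (card_gapIndex n)
  have hmod : n ^ 2 % 12 = (n % 6) ^ 2 % 12 := by
    have hsq : n ^ 2 = 12 * (3 * (n / 6) ^ 2 + (n % 6) * (n / 6)) + (n % 6) ^ 2 := by
      conv_lhs => rw [← Nat.div_add_mod n 6]
      ring
    rw [hsq, Nat.mul_add_mod]
  refine ⟨(dimAThetaOddKerAug_cyclic_eq_card n).trans (p3_sub_three_eq_card n).symm, ?_⟩
  have hcast : (n : ℚ) ^ 2 = (n ^ 2 : ℕ) := by push_cast; rfl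
  rw [hcast, hcard]
  generalize n ^ 2 = m at *
  have hdiv := Nat.div_add_mod (m + 6) 12
  generalize (m + 6) / 12 = q at *
  have hfinish (c d : ℕ) (h : 12 * q + c = m + d) : (q : ℚ) = 1 / 12 * m + (d - c) / 12 := by
    have : (12 * q + c : ℚ) = m + d := mod_cast h
    linarith
  refine ⟨fun h₂ h₃ => ?_, fun h₂ h₃ => ?_, fun h₂ h₃ => ?_, fun h₂ h₃ => ?_⟩
  · have hr : n % 6 = 0 := by omega
    rw [hr] at hmod
    rw [hfinish 0 0 (by omega)]
    norm_num
  · rw [hfinish 4 0 (by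
      obtain hr | hr : n % 6 = 2 ∨ n % 6 = 4 := by omega
      all_goals rw [hr] at hmod; omega)]
    ring
  · have hr : n % 6 = 3 := by omega
    rw [hr] at hmod
    rw [hfinish 0 3 (by omega)]
    norm_num
  · rw [hfinish 1 0 (by
      obtain hr | hr : n % 6 = 1 ∨ n % 6 = 5 := by omega
      all_goals rw [hr] at hmod; omega)]
    ring
end

section
/- Let m ≥ 1 and let p > 0 be even with gcd(m, 2p) = 1, and let π = (ℤ/mℤ) × D*₄ₚ. If p ≢ 0 mod 3 and m ≢ 0 mod 3, then dim_ℂ 𝒜_Θ^odd(ℂπ) = (1/6)m²p² + (1/2)m²p + (2/3)m² + (3/2)mp + (1/6)p² + m + (1/2)p + 1 and dim_ℂ 𝒜_Θ^odd(Ker ε) = (1/6)m²p² + (1/2)m²p + (2/3)m² + mp + (1/6)p² − (1/2)m − 1/2; otherwise dim_ℂ 𝒜_Θ^odd(ℂπ) = (1/6)m²p² + (1/2)m²p + (2/3)m² + (3/2)mp + (1/6)p² + m + (1/2)p + 4/3 and dim_ℂ 𝒜_Θ^odd(Ker ε) = (1/6)m²p² + (1/2)m²p + (2/3)m² + mp +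 (1/6)p² − (1/2)m − 1/6. -/
/-!
Statement 2: dimensions of `𝒜_Θ^odd(ℂπ)` and `𝒜_Θ^odd(Ker ε)` for
`π = (ℤ/mℤ) × D*₄ₚ` with `p` even, where `D*₄ₚ` is the binary dihedral (dicyclic) group
of order `4p` (Mathlib's `QuaternionGroup p`).

Identifying `(ℂπ)^{⊗3}` with functions `π³ → ℂ`, `dim 𝒜_Θ^odd(ℂπ)` (resp.
`dim 𝒜_Θ^odd(Ker ε)`) is the dimension of the space of functions `π³ → ℂ`
(resp. of such functions with vanishing marginal sums, cutting out `(Ker ε)^{⊗3}`)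
invariant under permutations of the coordinates, the two-sided action
`(x,y,z) ↦ (gxh⁻¹,gyh⁻¹,gzh⁻¹)` and coordinatewise inversion.
-/

open scoped BigOperators

section Averaging

/-- If the operators `f ↦ f ∘ T γ` average to a projection onto `W`, then `dim W` is the average
number of fixed points of the `T γ`. -/
theorem finrank_mul_card_eq_card_fixed {X Γ : Type*} [Fintype X] [Fintype Γ] [Nonempty Γ]
    (T : Γ → X → X) (W : Submodule ℂ (X → ℂ))
    (hW : ∀ f ∈ W, ∀ γ x, f (T γ x) = f x)
    (hT : ∀ f : X → ℂ, (fun x => ∑ γ, f (T γ x)) ∈ W) :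
    Module.finrank ℂ W * Fintype.card Γ = ∑ γ, Nat.card {x // T γ x = x} := by
  classical
  let P : (X → ℂ) →ₗ[ℂ] (X → ℂ) :=
    (Fintype.card Γ : ℂ)⁻¹ • ∑ γ, LinearMap.funLeft ℂ ℂ (T γ)
  have hcard : (Fintype.card Γ : ℂ) ≠ 0 := by simp
  have hP (f : X → ℂ) : P f = (Fintype.card Γ : ℂ)⁻¹ • fun x => ∑ γ, f (T γ x) := by
    ext x
    simp [P, LinearMap.funLeft_apply]
  have hproj : LinearMap.IsProj W P := by
    refine ⟨fun f => ?_, fun f hf => ?_⟩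
    · rw [hP]
      exact W.smul_mem _ (hT f)
    · rw [hP]
      ext x
      simp [hW f hf, hcard]
  have htr := hproj.trace
  rw [LinearMap.trace_eq_matrix_trace ℂ (Pi.basisFun ℂ X), Matrix.trace] at htr
  simp only [Matrix.diag_apply, LinearMap.toMatrix_apply, Pi.basisFun_apply, Pi.basisFun_repr, hP,
    Pi.smul_apply, smul_eq_mul, ← Finset.mul_sum] at htr
  rw [Finset.sum_comm, inv_mul_eq_iff_eq_mul₀ hcard] at htr
  have hfix (γ : Γ) : ∑ x, (Pi.single x 1 : X → ℂ) (T γ x) = (Nat.card {x // T γ x = x} : ℂ) := by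
    simp [Pi.single_apply, Nat.card_eq_fintype_card, Fintype.card_subtype]
  simp only [hfix] at htr
  rw [mul_comm]
  exact_mod_cast htr.symm

end Averaging

section Counting

theorem card_prod_subtype_eq_sum {α β : Type*} [Fintype α] [Finite β] (P : α → β → Prop) :
    Nat.card {q : α × β // P q.1 q.2} = ∑ a, Nat.card {b // P a b} := by
  rw [← Nat.card_sigma]
  exact Nat.card_congr
    { toFun := fun q => ⟨q.1.1, q.1.2, q.2⟩
      invFun := fun q => ⟨(q.1, q.2.1), q.2.2⟩
      left_inv := fun _ => rfl
      right_inv := fun _ => rfl }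

theorem card_prod_subtype_and {α β : Type*} (P : α → Prop) (Q : β → Prop) :
    Nat.card {q : α × β // P q.1 ∧ Q q.2} = Nat.card {a // P a} * Nat.card {b // Q b} := by
  rw [← Nat.card_prod]
  exact Nat.card_congr Equiv.subtypeProdEquivProd

/-- Apply `t` to the coordinates of a triple permuted by `σ`. -/
def permTriple {X : Type*} (σ : Equiv.Perm (Fin 3)) (t : X → X) (v : X × X × X) : X × X × X :=
  (t (![v.1, v.2.1, v.2.2] (σ 0)), t (![v.1, v.2.1, v.2.2] (σ 1)),
    t (![v.1, v.2.1, v.2.2] (σ 2)))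

theorem univ_perm_fin_three : (Finset.univ : Finset (Equiv.Perm (Fin 3))) =
    {1, Equiv.swap 0 1, Equiv.swap 0 2, Equiv.swap 1 2, finRotate 3, (finRotate 3)⁻¹} := by
  decide

/-- The cycle index of `S₃` counts the fixed points of a map on triples. -/
theorem sum_card_fixed_permTriple {X : Type*} (t : X → X) :
    ∑ σ : Equiv.Perm (Fin 3), Nat.card {v // permTriple σ t v = v} =
      Nat.card {x // t x = x} ^ 3 + 3 * (Nat.card {x // t x = x} * Nat.card {x // t (t x) = x}) +
        2 * Nat.card {x // t (t (t x)) = x} := by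
  have h1 : Nat.card {v // permTriple 1 t v = v} = Nat.card {x // t x = x} ^ 3 := by
    rw [pow_succ', pow_two, ← card_prod_subtype_and, ← card_prod_subtype_and]
    refine Nat.card_congr (Equiv.subtypeEquivRight fun v => ?_)
    simp [permTriple, Prod.ext_iff]
  have h2 : Nat.card {v // permTriple (Equiv.swap 0 1) t v = v} =
      Nat.card {x // t x = x} * Nat.card {x // t (t x) = x} := by
    have e0 : (Equiv.swap 0 1) (0 : Fin 3) = 1 := by decide
    have e1 : (Equiv.swap 0 1) (1 : Fin 3) = 0 := by decide
    have e2 : (Equiv.swap 0 1) (2 : Fin 3) = 2 := by decide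
    have hfix (v : X × X × X) : permTriple (Equiv.swap 0 1) t v = v ↔
        t v.2.1 = v.1 ∧ t v.1 = v.2.1 ∧ t v.2.2 = v.2.2 := by
      simp only [permTriple, Prod.ext_iff, e0, e1, e2]
      rfl
    simp only [hfix]
    rw [← card_prod_subtype_and]
    exact Nat.card_congr
      { toFun := fun v => ⟨(v.1.2.2, v.1.1), by grind⟩
        invFun := fun q => ⟨(q.1.2, t q.1.2, q.1.1), by grind⟩
        left_inv := by
          rintro ⟨⟨x, y, z⟩, h⟩
          grind
        right_inv := fun q => rfl }
  have h3 : Nat.card {v // permTriple (Equiv.swap 0 2) t v = v} =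
      Nat.card {x // t x = x} * Nat.card {x // t (t x) = x} := by
    have e0 : (Equiv.swap 0 2) (0 : Fin 3) = 2 := by decide
    have e1 : (Equiv.swap 0 2) (1 : Fin 3) = 1 := by decide
    have e2 : (Equiv.swap 0 2) (2 : Fin 3) = 0 := by decide
    have hfix (v : X × X × X) : permTriple (Equiv.swap 0 2) t v = v ↔
        t v.2.2 = v.1 ∧ t v.2.1 = v.2.1 ∧ t v.1 = v.2.2 := by
      simp only [permTriple, Prod.ext_iff, e0, e1, e2]
      rfl
    simp only [hfix]
    rw [← card_prod_subtype_and]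
    exact Nat.card_congr
      { toFun := fun v => ⟨(v.1.2.1, v.1.1), by grind⟩
        invFun := fun q => ⟨(q.1.2, q.1.1, t q.1.2), by grind⟩
        left_inv := by
          rintro ⟨⟨x, y, z⟩, h⟩
          grind
        right_inv := fun q => rfl }
  have h4 : Nat.card {v // permTriple (Equiv.swap 1 2) t v = v} =
      Nat.card {x // t x = x} * Nat.card {x // t (t x) = x} := by
    have e0 : (Equiv.swap 1 2) (0 : Fin 3) = 0 := by decide
    have e1 : (Equiv.swap 1 2) (1 : Fin 3) = 2 := by decide
    have e2 : (Equiv.swap 1 2) (2 : Fin 3) = 1 := by decide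
    have hfix (v : X × X × X) : permTriple (Equiv.swap 1 2) t v = v ↔
        t v.1 = v.1 ∧ t v.2.2 = v.2.1 ∧ t v.2.1 = v.2.2 := by
      simp only [permTriple, Prod.ext_iff, e0, e1, e2]
      rfl
    simp only [hfix]
    rw [← card_prod_subtype_and]
    exact Nat.card_congr
      { toFun := fun v => ⟨(v.1.1, v.1.2.1), by grind⟩
        invFun := fun q => ⟨(q.1.1, q.1.2, t q.1.2), by grind⟩
        left_inv := by
          rintro ⟨⟨x, y, z⟩, h⟩
          grind
        right_inv := fun q => rfl }
  have h5 : Nat.card {v // permTriple (finRotate 3) t v = v} =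
      Nat.card {x // t (t (t x)) = x} := by
    have e0 : (finRotate 3) (0 : Fin 3) = 1 := by decide
    have e1 : (finRotate 3) (1 : Fin 3) = 2 := by decide
    have e2 : (finRotate 3) (2 : Fin 3) = 0 := by decide
    have hfix (v : X × X × X) : permTriple (finRotate 3) t v = v ↔
        t v.2.1 = v.1 ∧ t v.2.2 = v.2.1 ∧ t v.1 = v.2.2 := by
      simp only [permTriple, Prod.ext_iff, e0, e1, e2]
      rfl
    simp only [hfix]
    exact Nat.card_congr
      { toFun := fun v => ⟨v.1.1, by grind⟩
        invFun := fun q => ⟨(q.1, t (t q.1), t q.1), by grind⟩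
        left_inv := by
          rintro ⟨⟨x, y, z⟩, h⟩
          grind
        right_inv := fun q => rfl }
  have h6 : Nat.card {v // permTriple (finRotate 3)⁻¹ t v = v} =
      Nat.card {x // t (t (t x)) = x} := by
    have e0 : (finRotate 3)⁻¹ (0 : Fin 3) = 2 := by decide
    have e1 : (finRotate 3)⁻¹ (1 : Fin 3) = 0 := by decide
    have e2 : (finRotate 3)⁻¹ (2 : Fin 3) = 1 := by decide
    have hfix (v : X × X × X) : permTriple (finRotate 3)⁻¹ t v = v ↔
        t v.2.2 = v.1 ∧ t v.1 = v.2.1 ∧ t v.2.1 = v.2.2 := by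
      simp only [permTriple, Prod.ext_iff, e0, e1, e2]
      rfl
    simp only [hfix]
    exact Nat.card_congr
      { toFun := fun v => ⟨v.1.1, by grind⟩
        invFun := fun q => ⟨(q.1, t q.1, t (t q.1)), by grind⟩
        left_inv := by
          rintro ⟨⟨x, y, z⟩, h⟩
          grind
        right_inv := fun q => rfl }
  rw [univ_perm_fin_three, Finset.sum_insert (by decide), Finset.sum_insert (by decide),
    Finset.sum_insert (by decide), Finset.sum_insert (by decide), Finset.sum_insert (by decide),
    Finset.sum_singleton, h1, h2, h3, h4, h5, h6]
  ring

end Counting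

section Relations

/-- The `k`-th moment of the out-degrees of a relation on a finite type. -/
noncomputable def relMoment {α : Type*} [Fintype α] (k : ℕ) (r : α → α → Prop) : ℕ :=
  ∑ a, Nat.card {b // r a b} ^ k

theorem relMoment_one {α : Type*} [Fintype α] (r : α → α → Prop) :
    relMoment 1 r = Nat.card {q : α × α // r q.1 q.2} := by
  simp [relMoment, card_prod_subtype_eq_sum]

theorem relMoment_two {α : Type*} [Fintype α] (r : α → α → Prop) :
    relMoment 2 r = Nat.card {q : α × α × α // r q.1 q.2.1 ∧ r q.1 q.2.2} := by
  rw [card_prod_subtype_eq_sum fun a (b : α × α) => r a b.1 ∧ r a b.2]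
  simp only [card_prod_subtype_and, relMoment, pow_two]

theorem relMoment_prod {α β : Type*} [Fintype α] [Fintype β] (k : ℕ) {r : α × β → α × β → Prop}
    (r₁ : α → α → Prop) (r₂ : β → β → Prop) (h : ∀ p q, r p q ↔ r₁ p.1 q.1 ∧ r₂ p.2 q.2) :
    relMoment k r = relMoment k r₁ * relMoment k r₂ := by
  simp only [relMoment, h, card_prod_subtype_and, mul_pow, Fintype.sum_prod_type,
    Finset.sum_mul_sum]

end Relations

section GroupCounts

variable (G : Type*) [Group G] [Fintype G]

theorem sum_card_translate_cube :
    ∑ γ : G × G, Nat.card {x // γ.1 * x * γ.2⁻¹ = x} ^ 3 =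
      Nat.card G * relMoment 2 fun g a : G => g * a = a * g := by
  have h (γ : G × G) : Nat.card {x // γ.1 * x * γ.2⁻¹ = x} ^ 3 =
      Nat.card {q : G × G × G // γ.1 * q.1 * γ.2⁻¹ = q.1 ∧ γ.1 * q.2.1 * γ.2⁻¹ = q.2.1 ∧
        γ.1 * q.2.2 * γ.2⁻¹ = q.2.2} := by
    rw [pow_succ', pow_two, ← card_prod_subtype_and, ← card_prod_subtype_and]
  simp only [h]
  rw [← card_prod_subtype_eq_sum fun (γ : G × G) (q : G × G × G) => γ.1 * q.1 * γ.2⁻¹ = q.1 ∧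
    γ.1 * q.2.1 * γ.2⁻¹ = q.2.1 ∧ γ.1 * q.2.2 * γ.2⁻¹ = q.2.2, relMoment_two, ← Nat.card_prod]
  refine Nat.card_congr
    { toFun := fun q => (q.1.2.1, ⟨(q.1.1.1, q.1.2.2.1 * q.1.2.1⁻¹, q.1.2.2.2 * q.1.2.1⁻¹), ?_⟩)
      invFun := fun q => ⟨((q.2.1.1, q.1⁻¹ * q.2.1.1 * q.1), q.1, q.2.1.2.1 * q.1,
        q.2.1.2.2 * q.1), ?_⟩
      left_inv := ?_
      right_inv := ?_ }
  · obtain ⟨⟨⟨g, h⟩, x, y, z⟩, h1, h2, h3⟩ := q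
    simp only [mul_inv_eq_iff_eq_mul] at h1 h2 h3
    obtain rfl : h = x⁻¹ * (g * x) := by rw [h1]; group
    simp only [← mul_assoc, h2, h3]
    simp [mul_assoc]
  · obtain ⟨x, ⟨g, a, b⟩, h1, h2⟩ := q
    simp only [← mul_assoc] at h1 h2 ⊢
    simp [mul_assoc]
    simp [← mul_assoc, h1, h2]
  · rintro ⟨⟨⟨g, h⟩, x, y, z⟩, h1, h2, h3⟩
    simp only [mul_inv_eq_iff_eq_mul] at h1
    obtain rfl : h = x⁻¹ * (g * x) := by rw [h1]; group
    simp [mul_assoc]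
  · rintro ⟨x, ⟨g, a, b⟩, h⟩
    simp

theorem sum_card_translate_mul_card_sq :
    ∑ γ : G × G, Nat.card {x // γ.1 * x * γ.2⁻¹ = x} *
        Nat.card {x // γ.1 * (γ.1 * x * γ.2⁻¹) * γ.2⁻¹ = x} =
      Nat.card G * relMoment 1 fun g a : G => g * g * a = a * (g * g) := by
  simp only [← card_prod_subtype_and]
  rw [← card_prod_subtype_eq_sum fun (γ : G × G) (q : G × G) => γ.1 * q.1 * γ.2⁻¹ = q.1 ∧
    γ.1 * (γ.1 * q.2 * γ.2⁻¹) * γ.2⁻¹ = q.2, relMoment_one, ← Nat.card_prod]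
  refine Nat.card_congr
    { toFun := fun q => (q.1.2.1, ⟨(q.1.1.1, q.1.2.2 * q.1.2.1⁻¹), ?_⟩)
      invFun := fun q => ⟨((q.2.1.1, q.1⁻¹ * q.2.1.1 * q.1), q.1, q.2.1.2 * q.1), ?_⟩
      left_inv := ?_
      right_inv := ?_ }
  · obtain ⟨⟨⟨g, h⟩, x, y⟩, h1, h2⟩ := q
    simp only [mul_inv_eq_iff_eq_mul] at h1 h2
    obtain rfl : h = x⁻¹ * (g * x) := by rw [h1]; group
    simp only [← mul_assoc, mul_inv_eq_iff_eq_mul] at h2 ⊢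
    simp [h2, mul_assoc]
  · obtain ⟨x, ⟨g, a⟩, h1⟩ := q
    simp only [← mul_assoc] at h1 ⊢
    simp [h1]
  · rintro ⟨⟨⟨g, h⟩, x, y⟩, h1, h2⟩
    simp only [mul_inv_eq_iff_eq_mul] at h1
    obtain rfl : h = x⁻¹ * (g * x) := by rw [h1]; group
    simp [mul_assoc]
  · rintro ⟨x, ⟨g, a⟩, h⟩
    simp

theorem sum_card_translate_cubed :
    ∑ γ : G × G, Nat.card {x // γ.1 * (γ.1 * (γ.1 * x * γ.2⁻¹) * γ.2⁻¹) * γ.2⁻¹ = x} =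
      Nat.card G * relMoment 1 fun g a : G => g * g * g = a * a * a := by
  rw [← card_prod_subtype_eq_sum fun (γ : G × G) (x : G) =>
    γ.1 * (γ.1 * (γ.1 * x * γ.2⁻¹) * γ.2⁻¹) * γ.2⁻¹ = x, relMoment_one, ← Nat.card_prod]
  refine Nat.card_congr
    { toFun := fun q => (q.1.2, ⟨(q.1.1.1, q.1.2 * q.1.1.2 * q.1.2⁻¹), ?_⟩)
      invFun := fun q => ⟨((q.2.1.1, q.1⁻¹ * q.2.1.2 * q.1), q.1), ?_⟩
      left_inv := ?_
      right_inv := ?_ }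
  · obtain ⟨⟨⟨g, h⟩, y⟩, h1⟩ := q
    simp only [← mul_assoc, mul_inv_eq_iff_eq_mul] at h1
    simpa [mul_assoc] using congrArg (· * y⁻¹) h1
  · obtain ⟨y, ⟨g, a⟩, h1⟩ := q
    simp only [← mul_assoc] at h1 ⊢
    simp [h1]
  · rintro ⟨⟨⟨g, h⟩, y⟩, h1⟩
    simp [mul_assoc]
  · rintro ⟨y, ⟨g, a⟩, h⟩
    simp [mul_assoc]

theorem sum_card_reflect_cube :
    ∑ γ : G × G, Nat.card {x // γ.1 * x⁻¹ * γ.2⁻¹ = x} ^ 3 =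
      Nat.card G * relMoment 2 fun u v : G => u * u = v * v := by
  have h (γ : G × G) : Nat.card {x // γ.1 * x⁻¹ * γ.2⁻¹ = x} ^ 3 =
      Nat.card {q : G × G × G // γ.1 * q.1⁻¹ * γ.2⁻¹ = q.1 ∧ γ.1 * q.2.1⁻¹ * γ.2⁻¹ = q.2.1 ∧
        γ.1 * q.2.2⁻¹ * γ.2⁻¹ = q.2.2} := by
    rw [pow_succ', pow_two, ← card_prod_subtype_and, ← card_prod_subtype_and]
  simp only [h]
  rw [← card_prod_subtype_eq_sum fun (γ : G × G) (q : G × G × G) => γ.1 * q.1⁻¹ * γ.2⁻¹ = q.1 ∧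
    γ.1 * q.2.1⁻¹ * γ.2⁻¹ = q.2.1 ∧ γ.1 * q.2.2⁻¹ * γ.2⁻¹ = q.2.2, relMoment_two,
    ← Nat.card_prod]
  simp only [mul_inv_eq_iff_eq_mul]
  refine Nat.card_congr
    { toFun := fun q => (q.1.1.2, ⟨(q.1.2.1 * q.1.1.2, q.1.2.2.1 * q.1.1.2,
        q.1.2.2.2 * q.1.1.2), ?_⟩)
      invFun := fun q => ⟨((q.2.1.1 * q.2.1.1 * q.1⁻¹, q.1), q.2.1.1 * q.1⁻¹, q.2.1.2.1 * q.1⁻¹,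
        q.2.1.2.2 * q.1⁻¹), ?_⟩
      left_inv := ?_
      right_inv := ?_ }
  · obtain ⟨⟨⟨g, h⟩, x, y, z⟩, h1, h2, h3⟩ := q
    simp only at h1 h2 h3
    simp only [← mul_assoc, ← h1, ← h2, ← h3, and_self]
  · obtain ⟨h, ⟨u, v, w⟩, h1, h2⟩ := q
    simp only at h1 h2
    refine ⟨?_, ?_, ?_⟩ <;> simp [← mul_assoc, ← h1, ← h2]
  · rintro ⟨⟨⟨g, h⟩, x, y, z⟩, h1, h2, h3⟩
    simp only at h1
    simp [h1, mul_assoc]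
  · rintro ⟨h, ⟨u, v, w⟩, h1⟩
    simp

theorem sum_card_reflect_mul_card_sq :
    ∑ γ : G × G, Nat.card {x // γ.1 * x⁻¹ * γ.2⁻¹ = x} *
        Nat.card {x // γ.1 * (γ.1 * x⁻¹ * γ.2⁻¹)⁻¹ * γ.2⁻¹ = x} =
      Nat.card G * relMoment 1 fun g a : G => g * g * a = a * (g * g) := by
  simp only [← card_prod_subtype_and]
  rw [← card_prod_subtype_eq_sum fun (γ : G × G) (q : G × G) => γ.1 * q.1⁻¹ * γ.2⁻¹ = q.1 ∧
    γ.1 * (γ.1 * q.2⁻¹ * γ.2⁻¹)⁻¹ * γ.2⁻¹ = q.2, relMoment_one, ← Nat.card_prod]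
  simp only [mul_inv_eq_iff_eq_mul, mul_inv_rev, inv_inv]
  refine Nat.card_congr
    { toFun := fun q => (q.1.1.2, ⟨(q.1.2.1 * q.1.1.2, q.1.2.2 * q.1.1.2), ?_⟩)
      invFun := fun q => ⟨((q.2.1.1 * q.2.1.1 * q.1⁻¹, q.1), q.2.1.1 * q.1⁻¹,
        q.2.1.2 * q.1⁻¹), ?_⟩
      left_inv := ?_
      right_inv := ?_ }
  · obtain ⟨⟨⟨g, h⟩, x, y⟩, h1, h2⟩ := q
    simp only [← mul_assoc, mul_inv_eq_iff_eq_mul] at h1 h2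
    simp only [← mul_assoc, ← h1, h2]
  · obtain ⟨h, ⟨u, a⟩, h1⟩ := q
    simp only at h1
    refine ⟨?_, ?_⟩
    · simp [← mul_assoc]
    · simp only [← mul_assoc, mul_inv_eq_iff_eq_mul] at h1 ⊢
      simp [h1]
  · rintro ⟨⟨⟨g, h⟩, x, y⟩, h1, h2⟩
    simp only at h1
    simp [h1, mul_assoc]
  · rintro ⟨h, ⟨u, v⟩, h1⟩
    simp

theorem sum_card_reflect_cubed :
    ∑ γ : G × G, Nat.card {x // γ.1 * (γ.1 * (γ.1 * x⁻¹ * γ.2⁻¹)⁻¹ * γ.2⁻¹)⁻¹ * γ.2⁻¹ = x} =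
      Nat.card G * relMoment 1 fun k u : G => k * k * k = u * u := by
  rw [← card_prod_subtype_eq_sum fun (γ : G × G) (x : G) =>
    γ.1 * (γ.1 * (γ.1 * x⁻¹ * γ.2⁻¹)⁻¹ * γ.2⁻¹)⁻¹ * γ.2⁻¹ = x, relMoment_one, ← Nat.card_prod]
  simp only [mul_inv_eq_iff_eq_mul, mul_inv_rev, inv_inv]
  refine Nat.card_congr
    { toFun := fun q => (q.1.1.2, ⟨(q.1.1.1 * q.1.1.2, q.1.2 * (q.1.1.2 * q.1.1.1 * q.1.1.2)), ?_⟩)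
      invFun := fun q => ⟨((q.2.1.1 * q.1⁻¹, q.1), q.2.1.2 * (q.1 * q.2.1.1)⁻¹), ?_⟩
      left_inv := ?_
      right_inv := ?_ }
  · obtain ⟨⟨⟨g, h⟩, y⟩, h1⟩ := q
    simp only [← mul_assoc, mul_inv_eq_iff_eq_mul] at h1 ⊢
    simp only [h1]
  · obtain ⟨h, ⟨k, u⟩, h1⟩ := q
    simp only [← mul_assoc] at h1 ⊢
    simp [mul_assoc]
    simp [← mul_assoc, h1]
  · rintro ⟨⟨⟨g, h⟩, y⟩, h1⟩
    simp [mul_assoc]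
  · rintro ⟨h, ⟨k, u⟩, h1⟩
    simp [mul_assoc]

theorem sum_card_conj :
    ∑ g : G, Nat.card {u // g * u * g⁻¹ = u} = relMoment 1 fun g a : G => g * a = a * g := by
  simp only [relMoment, pow_one, mul_inv_eq_iff_eq_mul]

theorem sum_card_conj_inv :
    ∑ g : G, Nat.card {u // g * u⁻¹ * g⁻¹ = u} = relMoment 1 fun u v : G => u * u = v * v := by
  simp only [relMoment, pow_one]
  refine Finset.sum_congr rfl fun g _ => Nat.card_congr
    ((Equiv.mulRight g).subtypeEquiv fun u => ?_)
  simp only [mul_inv_eq_iff_eq_mul, Equiv.coe_mulRight, ← mul_assoc, mul_left_inj]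

end GroupCounts

section Dimensions

variable (G : Type*) [Group G]

/-- The affine bijections `u ↦ g u h⁻¹` and `u ↦ g u⁻¹ h⁻¹` of a group. -/
def twist {G : Type*} [Group G] : Bool → G × G → G → G
  | false, γ, u => γ.1 * u * γ.2⁻¹
  | true, γ, u => γ.1 * u⁻¹ * γ.2⁻¹

/-- The functions on triples cut out by the symmetries defining `𝒜_Θ^odd(ℂG)`. -/
def invariantTriples : Submodule ℂ (G × G × G → ℂ) where
  carrier := { f |
      (∀ x y z : G, f (y, x, z) = f (x, y, z)) ∧
      (∀ x y z : G, f (x, z, y) = f (x, y, z)) ∧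
      (∀ g h x y z : G, f (g * x * h⁻¹, g * y * h⁻¹, g * z * h⁻¹) = f (x, y, z)) ∧
      (∀ x y z : G, f (x⁻¹, y⁻¹, z⁻¹) = f (x, y, z)) }
  add_mem' := by
    rintro f f' ⟨h1, h2, h3, h4⟩ ⟨h1', h2', h3', h4'⟩
    refine ⟨fun x y z => ?_, fun x y z => ?_, fun g h x y z => ?_, fun x y z => ?_⟩
    · simp only [Pi.add_apply, h1 x y z, h1' x y z]
    · simp only [Pi.add_apply, h2 x y z, h2' x y z]
    · simp only [Pi.add_apply, h3, h3']
    · simp only [Pi.add_apply, h4, h4']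
  zero_mem' := by simp
  smul_mem' := by
    rintro c f ⟨h1, h2, h3, h4⟩
    refine ⟨fun x y z => ?_, fun x y z => ?_, fun g h x y z => ?_, fun x y z => ?_⟩
    · simp only [Pi.smul_apply, h1 x y z]
    · simp only [Pi.smul_apply, h2 x y z]
    · simp only [Pi.smul_apply, h3]
    · simp only [Pi.smul_apply, h4]

/-- The class functions invariant under inversion. -/
def invariantClassFunctions : Submodule ℂ (G → ℂ) where
  carrier := { φ | (∀ g u : G, φ (g * u * g⁻¹) = φ u) ∧ ∀ u : G, φ u⁻¹ = φ u }
  add_mem' := by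
    rintro f f' ⟨h1, h2⟩ ⟨h1', h2'⟩
    exact ⟨fun g u => by simp only [Pi.add_apply, h1, h1'],
      fun u => by simp only [Pi.add_apply, h2, h2']⟩
  zero_mem' := by simp
  smul_mem' := by
    rintro c f ⟨h1, h2⟩
    exact ⟨fun g u => by simp only [Pi.smul_apply, h1], fun u => by simp only [Pi.smul_apply, h2]⟩

variable {G} in
theorem apply_permTriple_of_mem {f : G × G × G → ℂ} (hf : f ∈ invariantTriples G)
    (σ : Equiv.Perm (Fin 3)) (t : G → G) (v : G × G × G) :
    f (permTriple σ t v) = f (t v.1, t v.2.1, t v.2.2) := by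
  obtain ⟨h1, h2, -, -⟩ := hf
  obtain ⟨x, y, z⟩ := v
  have hσ : σ ∈ ({1, Equiv.swap 0 1, Equiv.swap 0 2, Equiv.swap 1 2, finRotate 3,
      (finRotate 3)⁻¹} : Finset (Equiv.Perm (Fin 3))) :=
    univ_perm_fin_three ▸ Finset.mem_univ σ
  simp only [Finset.mem_insert, Finset.mem_singleton] at hσ
  rcases hσ with rfl | rfl | rfl | rfl | rfl | rfl
  · rfl
  · exact h1 _ _ _
  · exact (h1 _ _ _).trans ((h2 _ _ _).trans (h1 _ _ _))
  · exact h2 _ _ _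
  · exact (h2 _ _ _).trans (h1 _ _ _)
  · exact (h1 _ _ _).trans (h2 _ _ _)

variable {G} in
theorem permTriple_twist_apply_of_mem {f : G × G × G → ℂ} (hf : f ∈ invariantTriples G)
    (σ : Equiv.Perm (Fin 3)) (b : Bool) (γ : G × G) (v : G × G × G) :
    f (permTriple σ (twist b γ) v) = f v := by
  rw [apply_permTriple_of_mem hf]
  obtain ⟨-, -, h3, h4⟩ := hf
  cases b
  · exact h3 _ _ _ _ _
  · exact (h3 _ _ _ _ _).trans (h4 _ _ _)

theorem permTriple_comp {X : Type*} (σ : Equiv.Perm (Fin 3)) (t s : X → X) (x y z : X) :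
    permTriple σ t (s x, s y, s z) = permTriple σ (t ∘ s) (x, y, z) := by
  have h (i : Fin 3) : ![s x, s y, s z] i = s (![x, y, z] i) := by fin_cases i <;> rfl
  simp only [permTriple, h, Function.comp_apply]

variable {G} in
theorem sum_permTriple_twist_mem [Fintype G] (f : G × G × G → ℂ) :
    (fun v => ∑ γ : Equiv.Perm (Fin 3) × Bool × G × G, f (permTriple γ.1 (twist γ.2.1 γ.2.2) v)) ∈
      invariantTriples G := by
  refine ⟨fun x y z => ?_, fun x y z => ?_, fun g h x y z => ?_, fun x y z => ?_⟩
  · refine Fintype.sum_equiv ((Equiv.mulLeft (Equiv.swap 0 1)).prodCongr (Equiv.refl _)) _ _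
      fun γ => ?_
    have h (i : Fin 3) : ![y, x, z] i = ![x, y, z] (Equiv.swap 0 1 i) := by fin_cases i <;> rfl
    simp only [permTriple, h]
    rfl
  · refine Fintype.sum_equiv ((Equiv.mulLeft (Equiv.swap 1 2)).prodCongr (Equiv.refl _)) _ _
      fun γ => ?_
    have h (i : Fin 3) : ![x, z, y] i = ![x, y, z] (Equiv.swap 1 2 i) := by fin_cases i <;> rfl
    simp only [permTriple, h]
    rfl
  · simp only [Fintype.sum_prod_type (f := fun γ : Equiv.Perm (Fin 3) × Bool × G × G => _),
      Fintype.sum_prod_type (f := fun γ : Bool × G × G => _), Fintype.sum_bool]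
    refine Finset.sum_congr rfl fun σ _ => congrArg₂ (· + ·) ?_ ?_
    · refine Fintype.sum_equiv ((Equiv.mulRight h).prodCongr (Equiv.mulRight g)) _ _ fun γ => ?_
      rw [permTriple_comp σ _ (fun u => g * u * h⁻¹)]
      congr 2
      ext u
      simp [twist, mul_assoc]
    · refine Fintype.sum_equiv ((Equiv.mulRight g).prodCongr (Equiv.mulRight h)) _ _ fun γ => ?_
      rw [permTriple_comp σ _ (fun u => g * u * h⁻¹)]
      congr 2
      ext u
      simp [twist, mul_assoc]
  · simp only [Fintype.sum_prod_type (f := fun γ : Equiv.Perm (Fin 3) × Bool × G × G => _),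
      Fintype.sum_prod_type (f := fun γ : Bool × G × G => _), Fintype.sum_bool]
    refine Finset.sum_congr rfl fun σ _ => ?_
    rw [add_comm]
    refine congrArg₂ (· + ·) ?_ ?_
    · refine Fintype.sum_congr _ _ fun γ => ?_
      rw [permTriple_comp σ _ (fun u => u⁻¹)]
      rfl
    · refine Fintype.sum_congr _ _ fun γ => ?_
      rw [permTriple_comp σ _ (fun u => u⁻¹)]
      congr 2
      ext u
      simp [twist]

theorem finrank_invariantTriples_mul [Fintype G] :
    Module.finrank ℂ (invariantTriples G) * (12 * Nat.card G) =
      (relMoment 2 fun g a : G => g * a = a * g) +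
      6 * (relMoment 1 fun g a : G => g * g * a = a * (g * g)) +
      2 * (relMoment 1 fun g a : G => g * g * g = a * a * a) +
      (relMoment 2 fun u v : G => u * u = v * v) +
      2 * (relMoment 1 fun k u : G => k * k * k = u * u) := by
  have key := finrank_mul_card_eq_card_fixed
    (fun γ : Equiv.Perm (Fin 3) × Bool × G × G => permTriple γ.1 (twist γ.2.1 γ.2.2))
    (invariantTriples G) (fun f hf γ v => permTriple_twist_apply_of_mem hf _ _ _ _)
    sum_permTriple_twist_mem
  rw [Fintype.sum_prod_type, Finset.sum_comm] at key
  simp only [sum_card_fixed_permTriple] at key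
  rw [Fintype.sum_prod_type, Fintype.sum_bool] at key
  simp only [twist, Finset.sum_add_distrib, ← Finset.mul_sum, sum_card_translate_cube,
    sum_card_translate_mul_card_sq, sum_card_translate_cubed, sum_card_reflect_cube,
    sum_card_reflect_mul_card_sq, sum_card_reflect_cubed] at key
  have hcard : Fintype.card (Equiv.Perm (Fin 3) × Bool × G × G) =
      12 * (Nat.card G * Nat.card G) := by
    simp [Fintype.card_perm, Nat.factorial, ← mul_assoc]
  rw [hcard] at key
  have hG : 0 < Nat.card G := Nat.card_pos
  refine Nat.eq_of_mul_eq_mul_left hG ?_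
  linarith

theorem finrank_invariantClassFunctions_mul [Fintype G] :
    Module.finrank ℂ (invariantClassFunctions G) * (2 * Nat.card G) =
      (relMoment 1 fun g a : G => g * a = a * g) + relMoment 1 fun u v : G => u * u = v * v := by
  have key := finrank_mul_card_eq_card_fixed (fun γ : Bool × G => twist γ.1 (γ.2, γ.2))
    (invariantClassFunctions G) ?_ ?_
  · rw [Fintype.sum_prod_type, Fintype.sum_bool] at key
    simp only [twist, sum_card_conj, sum_card_conj_inv] at key
    simpa [add_comm] using key
  · rintro φ ⟨h1, h2⟩ ⟨b | b, g⟩ u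
    · exact h1 g u
    · exact (h1 g _).trans (h2 u)
  · intro φ
    simp only [Fintype.sum_prod_type, Fintype.sum_bool, twist]
    refine ⟨fun g u => congrArg₂ (· + ·) ?_ ?_, fun u => ?_⟩
    · refine Fintype.sum_equiv (Equiv.mulRight g) _ _ fun k => ?_
      simp [mul_assoc]
    · refine Fintype.sum_equiv (Equiv.mulRight g) _ _ fun k => ?_
      simp [mul_assoc]
    · simp [add_comm]

theorem dimAThetaOddGroupAlgebra_eq :
    dimAThetaOddGroupAlgebra G = Module.finrank ℂ (invariantTriples G) := by
  have h := Submodule.span_eq (invariantTriples G)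
  exact congrArg (fun W : Submodule ℂ (G × G × G → ℂ) => Module.finrank ℂ W) h

/-- Summing an invariant function on triples over the first coordinate. -/
def marginal [Fintype G] : invariantTriples G →ₗ[ℂ] (G → ℂ) where
  toFun f u := ∑ x, f.1 (x, u, 1)
  map_add' f f' := by
    ext u
    simp [Finset.sum_add_distrib]
  map_smul' c f := by
    ext u
    simp [Finset.mul_sum]

variable {G} in
theorem sum_eq_marginal [Fintype G] (f : invariantTriples G) (y z : G) :
    ∑ x, f.1 (x, y, z) = marginal G f (y * z⁻¹) := by
  refine Fintype.sum_equiv (Equiv.mulRight z⁻¹) _ _ fun x => ?_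
  simpa using (f.2.2.2.1 1 z x y z).symm

theorem range_marginal [Fintype G] :
    LinearMap.range (marginal G) = invariantClassFunctions G := by
  apply le_antisymm
  · rintro _ ⟨f, rfl⟩
    refine ⟨fun g u => ?_, fun u => ?_⟩
    · refine (Fintype.sum_equiv (MulAut.conj g).toEquiv _ _ fun x => ?_).symm
      simpa using (f.2.2.2.1 g g x u 1).symm
    · have h1 := sum_eq_marginal f 1 u
      have h2 := sum_eq_marginal f u 1
      rw [one_mul] at h1
      rw [inv_one, mul_one] at h2
      rw [← h1, ← h2]
      exact Finset.sum_congr rfl fun x _ => f.2.2.1 x u 1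
  · rintro φ ⟨h1, h2⟩
    have hn : (Fintype.card G : ℂ) ≠ 0 := by simp
    have hsymm (x y : G) : φ (y * x⁻¹) = φ (x * y⁻¹) := by
      rw [← h2]
      simp
    have hconj (x y : G) : φ (x * y) = φ (y * x) := by
      rw [← h1 y (x * y)]
      simp [mul_assoc]
    let c : ℂ := ∑ x, φ x
    refine ⟨⟨fun v => (Fintype.card G : ℂ)⁻¹ * (φ (v.1 * v.2.1⁻¹) + φ (v.2.1 * v.2.2⁻¹) +
      φ (v.1 * v.2.2⁻¹) - 2 * c * (Fintype.card G : ℂ)⁻¹), ?_, ?_, ?_, ?_⟩, ?_⟩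
    · intro x y z
      simp only [hsymm x y]
      ring
    · intro x y z
      simp only [hsymm y z]
      ring
    · intro g h x y z
      have hred (a b : G) : φ (g * a * h⁻¹ * (g * b * h⁻¹)⁻¹) = φ (a * b⁻¹) := by
        rw [← h1 g (a * b⁻¹)]
        congr 1
        group
      simp only [hred]
    · intro x y z
      have hred (a b : G) : φ (a⁻¹ * b⁻¹⁻¹) = φ (a * b⁻¹) := by
        rw [inv_inv, hconj, hsymm]
      simp only [hred]
    · ext u
      have hsum (w : G) : ∑ x, φ (x * w⁻¹) = c :=
        Fintype.sum_equiv (Equiv.mulRight w⁻¹) _ _ fun x => rfl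
      have hsum1 := hsum 1
      rw [inv_one] at hsum1
      simp only [mul_one] at hsum1
      change ∑ x, _ = _
      rw [← Finset.mul_sum]
      simp only [inv_one, mul_one, Finset.sum_sub_distrib, Finset.sum_add_distrib, hsum, hsum1,
        Finset.sum_const, Finset.card_univ, nsmul_eq_mul]
      field_simp
      ring

theorem dimAThetaOddKerAug_add [Fintype G] :
    dimAThetaOddKerAug G + Module.finrank ℂ (invariantClassFunctions G) =
      Module.finrank ℂ (invariantTriples G) := by
  rw [← range_marginal, ← LinearMap.finrank_range_add_finrank_ker (marginal G), add_comm]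
  congr 1
  have hker : { f : G × G × G → ℂ |
      (∀ x y z : G, f (y, x, z) = f (x, y, z)) ∧
      (∀ x y z : G, f (x, z, y) = f (x, y, z)) ∧
      (∀ g h x y z : G, f (g * x * h⁻¹, g * y * h⁻¹, g * z * h⁻¹) = f (x, y, z)) ∧
      (∀ x y z : G, f (x⁻¹, y⁻¹, z⁻¹) = f (x, y, z)) ∧
      (∀ y z : G, ∑ᶠ x : G, f (x, y, z) = 0) ∧
      (∀ x z : G, ∑ᶠ y : G, f (x, y, z) = 0) ∧
      (∀ x y : G, ∑ᶠ z : G, f (x, y, z) = 0) } =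
      (((LinearMap.ker (marginal G)).map (invariantTriples G).subtype :
        Submodule ℂ (G × G × G → ℂ)) : Set (G × G × G → ℂ)) := by
    ext f
    simp only [finsum_eq_sum_of_fintype, Set.mem_ofPred_eq, SetLike.mem_coe, Submodule.mem_map,
      LinearMap.mem_ker, Submodule.subtype_apply]
    constructor
    · rintro ⟨h1, h2, h3, h4, h5, -, -⟩
      exact ⟨⟨f, h1, h2, h3, h4⟩, funext fun u => h5 u 1, rfl⟩
    · rintro ⟨f, hf, rfl⟩
      obtain ⟨h1, h2, h3, h4⟩ := f.2
      have hsum (y z : G) : ∑ x, f.1 (x, y, z) = 0 := by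
        rw [sum_eq_marginal, hf]
        rfl
      refine ⟨h1, h2, h3, h4, hsum, fun x z => ?_, fun x y => ?_⟩
      · rw [← hsum x z]
        exact Finset.sum_congr rfl fun y _ => h1 y x z
      · rw [← hsum x y]
        exact Finset.sum_congr rfl fun z _ => ((h1 x z y).trans (h2 x y z)).symm
  rw [dimAThetaOddKerAug, hker, Submodule.span_eq]
  exact Submodule.finrank_map_subtype_eq _ _

end Dimensions

section CyclicCounts

theorem IsCyclic.card_pow_eq_pow {A : Type*} [CommGroup A] [IsCyclic A] [Finite A] (k : ℕ)
    (g : A) : Nat.card {a : A // a ^ k = g ^ k} = (Nat.card A).gcd k := by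
  rw [← IsCyclic.card_powMonoidHom_ker]
  refine Nat.card_congr ((Equiv.mulRight g⁻¹).subtypeEquiv fun a => ?_)
  rw [MonoidHom.mem_ker, powMonoidHom_apply, Equiv.coe_mulRight, mul_pow, inv_pow,
    mul_inv_eq_one]

theorem relMoment_of_forall_card {α : Type*} [Fintype α] (k c : ℕ) {r : α → α → Prop}
    (h : ∀ a, Nat.card {b // r a b} = c) : relMoment k r = Nat.card α * c ^ k := by
  simp [relMoment, h]

theorem card_mul_self_eq_of_odd {A : Type*} [CommGroup A] (hA : Odd (Nat.card A)) (c : A) :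
    Nat.card {a : A // c = a * a} = 1 := by
  rw [← Nat.card_unique (α := {a : A // a = c})]
  refine Nat.card_congr ((powCoprime hA.coprime_two_right).subtypeEquiv fun a => ?_)
  rw [powCoprime_apply, pow_two, eq_comm]

variable (A : Type*) [CommGroup A] [Fintype A]

theorem relMoment_comm_of_commGroup (k : ℕ) :
    (relMoment k fun g a : A => g * a = a * g) = Nat.card A * Nat.card A ^ k :=
  relMoment_of_forall_card k _ fun g => by
    simp [mul_comm g]

theorem relMoment_sq_comm_of_commGroup :
    (relMoment 1 fun g a : A => g * g * a = a * (g * g)) = Nat.card A * Nat.card A := by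
  rw [relMoment_of_forall_card 1 (Nat.card A) fun g => by simp [mul_comm (g * g)], pow_one]

theorem relMoment_cube_eq_cube_of_isCyclic [IsCyclic A] :
    (relMoment 1 fun g a : A => g * g * g = a * a * a) = Nat.card A * (Nat.card A).gcd 3 := by
  rw [relMoment_of_forall_card 1 ((Nat.card A).gcd 3) fun g => ?_, pow_one]
  rw [← IsCyclic.card_pow_eq_pow 3 g]
  exact Nat.card_congr (Equiv.subtypeEquivRight fun a => by rw [pow_three', pow_three', eq_comm])

theorem relMoment_sq_eq_sq_of_odd (hA : Odd (Nat.card A)) (k : ℕ) :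
    (relMoment k fun u v : A => u * u = v * v) = Nat.card A := by
  rw [relMoment_of_forall_card k 1 fun u => card_mul_self_eq_of_odd hA _, one_pow, mul_one]

theorem relMoment_cube_eq_sq_of_odd (hA : Odd (Nat.card A)) :
    (relMoment 1 fun k u : A => k * k * k = u * u) = Nat.card A := by
  rw [relMoment_of_forall_card 1 1 fun u => card_mul_self_eq_of_odd hA _, one_pow, mul_one]

end CyclicCounts

section ZModCounts

theorem ZMod.card_natCast_mul_eq (n k : ℕ) [NeZero n] {c i₀ : ZMod n} (h : k * i₀ = c) :
    Nat.card {i : ZMod n // k * i = c} = n.gcd k := by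
  have hker := IsAddCyclic.card_nsmulAddMonoidHom_ker (ZMod n) k
  rw [Nat.card_zmod] at hker
  rw [← hker]
  refine Nat.card_congr ((Equiv.subRight i₀).subtypeEquiv fun i => ?_)
  rw [AddMonoidHom.mem_ker, nsmulAddMonoidHom_apply, nsmul_eq_mul, Equiv.subRight_apply, mul_sub,
    h, sub_eq_zero]

theorem sum_add_card_const_pow {α β : Type*} [Fintype α] [Finite β] (A k : ℕ) (P : α → Prop) :
    ∑ a, (A + Nat.card {_b : β // P a}) ^ k + Nat.card {a // P a} * A ^ k =
      Nat.card α * A ^ k + Nat.card {a // P a} * (A + Nat.card β) ^ k := by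
  classical
  have h (a : α) : (A + Nat.card {_b : β // P a}) ^ k =
      if P a then (A + Nat.card β) ^ k else A ^ k := by
    split_ifs with h <;> simp [h]
  have hcard := Fintype.card_subtype_compl P
  have hle := Fintype.card_subtype_le P
  simp only [h, Finset.sum_ite, Finset.sum_const, smul_eq_mul, ← Fintype.card_subtype,
    Nat.card_eq_fintype_card]
  rw [hcard]
  obtain ⟨d, hd⟩ := Nat.exists_eq_add_of_le hle
  rw [hd, Nat.add_sub_cancel_left]
  ring

end ZModCounts

namespace QuaternionGroup

/-- The elements of `QuaternionGroup n` as a disjoint union of two copies of `ZMod (2 * n)`. -/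
def sumEquiv (n : ℕ) : ZMod (2 * n) ⊕ ZMod (2 * n) ≃ QuaternionGroup n where
  toFun := Sum.elim a xa
  invFun
    | a i => Sum.inl i
    | xa i => Sum.inr i
  left_inv := by rintro (i | i) <;> rfl
  right_inv := by rintro (i | i) <;> rfl

theorem natCast_add_self (p : ℕ) : (p : ZMod (2 * p)) + p = 0 := by
  rw [← two_mul]
  exact_mod_cast ZMod.natCast_self (2 * p)

theorem gcd_two_mul_three (p : ℕ) : (2 * p).gcd 3 = p.gcd 3 :=
  Nat.Coprime.gcd_mul_left_cancel p (by norm_num)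

variable {p : ℕ} [NeZero p]

theorem sum_eq (F : QuaternionGroup p → ℕ) : ∑ q, F q = ∑ i, F (a i) + ∑ i, F (xa i) := by
  exact ((sumEquiv p).sum_comp F).symm.trans (Fintype.sum_sum_type _)

theorem card_subtype_eq (P : QuaternionGroup p → Prop) :
    Nat.card {q // P q} = Nat.card {i // P (a i)} + Nat.card {i // P (xa i)} := by
  rw [← Nat.card_sum]
  exact Nat.card_congr
    (((sumEquiv p).subtypeEquiv fun _ => Iff.rfl).symm.trans
      (Equiv.subtypeSum (p := fun s => P (sumEquiv p s))))

theorem relMoment_eq (k : ℕ) (r : QuaternionGroup p → QuaternionGroup p → Prop) :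
    relMoment k r =
      ∑ i, (Nat.card {j // r (a i) (a j)} + Nat.card {j // r (a i) (xa j)}) ^ k +
      ∑ i, (Nat.card {j // r (xa i) (a j)} + Nat.card {j // r (xa i) (xa j)}) ^ k := by
  simp only [relMoment, sum_eq, card_subtype_eq]

theorem card_add_self_eq_zero : Nat.card {i : ZMod (2 * p) // i + i = 0} = 2 := by
  have h := ZMod.card_natCast_mul_eq (2 * p) 2 (c := 0) (i₀ := 0) (mul_zero _)
  simpa only [Nat.cast_ofNat, two_mul (_ : ZMod (2 * p)), Nat.gcd_mul_right_left] using h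

theorem card_add_self_eq_add_self (i : ZMod (2 * p)) :
    Nat.card {j : ZMod (2 * p) // i + i = j + j} = 2 := by
  refine (Nat.card_congr ((Equiv.subRight i).subtypeEquiv fun j => ?_)).trans card_add_self_eq_zero
  rw [Equiv.subRight_apply]
  constructor <;> intro h <;> linear_combination -h

theorem card_add_self_eq_natCast (hp : Even p) :
    Nat.card {i : ZMod (2 * p) // i + i = p} = 2 := by
  obtain ⟨q, hq⟩ := hp
  refine (Nat.card_congr (Equiv.subtypeEquivRight fun i => ?_)).trans
    (card_add_self_eq_add_self (q : ZMod (2 * p)))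
  rw [eq_comm, ← Nat.cast_add, ← hq]

theorem card_four_mul_eq_zero (hp : Even p) :
    Nat.card {i : ZMod (2 * p) // i + i + (i + i) = 0} = 4 := by
  have h := ZMod.card_natCast_mul_eq (2 * p) 4 (c := 0) (i₀ := 0) (mul_zero _)
  have hdvd : (2 * p).gcd 4 = 4 := by
    obtain ⟨q, rfl⟩ := hp
    exact Nat.gcd_eq_right ⟨q, by ring⟩
  rw [hdvd] at h
  rw [← h]
  refine Nat.card_congr (Equiv.subtypeEquivRight fun i => ?_)
  have : i + i + (i + i) = ((4 : ℕ) : ZMod (2 * p)) * i := by push_cast; ring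
  rw [this]

theorem card_three_mul_eq (i : ZMod (2 * p)) :
    Nat.card {j : ZMod (2 * p) // i + i + i = j + j + j} = p.gcd 3 := by
  rw [← gcd_two_mul_three, ← ZMod.card_natCast_mul_eq (2 * p) 3 (i₀ := i) rfl]
  refine Nat.card_congr (Equiv.subtypeEquivRight fun j => ?_)
  push_cast
  constructor <;> intro h <;> linear_combination -h

theorem card_three_mul_eq_natCast :
    Nat.card {i : ZMod (2 * p) // i + i + i = p} = p.gcd 3 := by
  rw [← card_three_mul_eq (p := p) (p : ZMod (2 * p))]
  refine Nat.card_congr (Equiv.subtypeEquivRight fun i => ?_)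
  rw [natCast_add_self, zero_add, eq_comm]

theorem sum_card_three_mul_eq_two_mul :
    ∑ i : ZMod (2 * p), Nat.card {j : ZMod (2 * p) // i + i + i = j + j} = 2 * p := by
  rw [← card_prod_subtype_eq_sum fun i j : ZMod (2 * p) => i + i + i = j + j]
  trans Nat.card (ZMod (2 * p))
  · exact Nat.card_congr
      { toFun := fun q => q.1.2 - q.1.1
        invFun := fun k => ⟨(k + k, k + k + k), by ring⟩
        left_inv := by
          rintro ⟨⟨i, j⟩, h⟩
          simp only at h
          simp only [Subtype.mk.injEq, Prod.mk.injEq]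
          exact ⟨by linear_combination -h, by linear_combination -h⟩
        right_inv := fun k => by simp }
  · exact Nat.card_zmod _

theorem relMoment_comm (k : ℕ) :
    (relMoment k fun g h : QuaternionGroup p => g * h = h * g) + 2 * (2 * p) ^ k =
      2 * p * (2 * p) ^ k + 2 * (4 * p) ^ k + 2 * p * 4 ^ k := by
  rw [relMoment_eq]
  have e1 (i j : ZMod (2 * p)) : (j - i = j + i) ↔ i + i = 0 := by
    constructor <;> intro h <;> linear_combination -h
  have e2 (i j : ZMod (2 * p)) : (i + j = i - j) ↔ j + j = 0 := by
    constructor <;> intro h <;> linear_combination h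
  have e3 (i j : ZMod (2 * p)) : ((p : ZMod (2 * p)) + j - i = p + i - j) ↔ i + i = j + j := by
    constructor <;> intro h <;> linear_combination -h
  have key := sum_add_card_const_pow (β := ZMod (2 * p)) (2 * p) k
    fun i : ZMod (2 * p) => i + i = 0
  have htrue (i : ZMod (2 * p)) : Nat.card {j : ZMod (2 * p) // i + j = j + i} = 2 * p := by
    simp [add_comm i]
  simp only [card_add_self_eq_zero, Nat.card_zmod] at key
  simp only [a_mul_a, a_mul_xa, xa_mul_a, xa_mul_xa, a.injEq, xa.injEq, e1, e2, e3, htrue,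
    card_add_self_eq_zero, card_add_self_eq_add_self, Finset.sum_const, Finset.card_univ,
    ZMod.card, smul_eq_mul, Nat.reduceAdd]
  rw [show 4 * p = 2 * p + 2 * p by ring]
  linarith

theorem relMoment_sq_comm (hp : Even p) :
    (relMoment 1 fun g h : QuaternionGroup p => g * g * h = h * (g * g)) =
      12 * p ^ 2 + 8 * p := by
  rw [relMoment_eq]
  have e1 (i j : ZMod (2 * p)) : (j - (i + i) = j + (i + i)) ↔ i + i + (i + i) = 0 := by
    constructor <;> intro h <;> linear_combination -h
  have e2 (j : ZMod (2 * p)) : j - (p : ZMod (2 * p)) = j + p := by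
    linear_combination -natCast_add_self p
  have key := sum_add_card_const_pow (β := ZMod (2 * p)) (2 * p) 1
    fun i : ZMod (2 * p) => i + i + (i + i) = 0
  have htrue (c : ZMod (2 * p)) : Nat.card {j : ZMod (2 * p) // c + j = j + c} = 2 * p := by
    simp [add_comm c]
  have htrue' : Nat.card {_j : ZMod (2 * p) // True} = 2 * p := by simp
  simp only [card_four_mul_eq_zero hp, Nat.card_zmod] at key
  simp only [a_mul_a, a_mul_xa, xa_mul_a, xa_mul_xa, a.injEq, xa.injEq, e1, add_sub_cancel_right,
    e2, htrue, htrue', Finset.sum_const, Finset.card_univ, ZMod.card, smul_eq_mul]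
  nlinarith

theorem relMoment_cube_eq_cube :
    (relMoment 1 fun g h : QuaternionGroup p => g * g * g = h * h * h) =
      2 * p * (p.gcd 3 + 1) := by
  rw [relMoment_eq]
  have e1 (i : ZMod (2 * p)) : Nat.card {j : ZMod (2 * p) // i = j} = 1 := by simp
  simp only [a_mul_a, a_mul_xa, xa_mul_xa, a.injEq, xa.injEq, add_sub_cancel_right,
    sub_left_inj, e1, reduceCtorEq, card_three_mul_eq, Nat.card_of_isEmpty, Finset.sum_const,
    Finset.card_univ, ZMod.card, smul_eq_mul, pow_one]
  ring

theorem relMoment_sq_eq_sq (hp : Even p) (k : ℕ) :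
    (relMoment k fun g h : QuaternionGroup p => g * g = h * h) + 2 * 2 ^ k =
      2 * p * 2 ^ k + 2 * (2 + 2 * p) ^ k + 2 * p * (2 + 2 * p) ^ k := by
  rw [relMoment_eq]
  have e1 : Nat.card {j : ZMod (2 * p) // (p : ZMod (2 * p)) = j + j} = 2 := by
    simp only [eq_comm (a := (p : ZMod (2 * p))), card_add_self_eq_natCast hp]
  have htrue : Nat.card {_j : ZMod (2 * p) // True} = 2 * p := by simp
  have key := sum_add_card_const_pow (β := ZMod (2 * p)) 2 k
    fun i : ZMod (2 * p) => i + i = p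
  simp only [card_add_self_eq_natCast hp, Nat.card_zmod] at key
  simp only [a_mul_a, xa_mul_xa, a.injEq, add_sub_cancel_right, e1, htrue,
    card_add_self_eq_add_self, Finset.sum_const, Finset.card_univ, ZMod.card, smul_eq_mul]
  linarith

theorem relMoment_cube_eq_sq :
    (relMoment 1 fun g h : QuaternionGroup p => g * g * g = h * h) =
      2 * p * (p.gcd 3 + 1) := by
  rw [relMoment_eq]
  have key := sum_add_card_const_pow (β := ZMod (2 * p)) 0 1
    fun i : ZMod (2 * p) => i + i + i = p
  simp only [card_three_mul_eq_natCast, Nat.card_zmod, zero_add, pow_one, mul_zero,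
    add_zero] at key
  simp only [a_mul_a, a_mul_xa, xa_mul_xa, a.injEq, add_sub_cancel_right, reduceCtorEq,
    Nat.card_of_isEmpty, Finset.sum_const_zero, pow_one, Finset.sum_add_distrib,
    sum_card_three_mul_eq_two_mul, key]
  ring

end QuaternionGroup

section Product

variable (m p : ℕ) [NeZero m] [NeZero p]

theorem finrank_invariantTriples_zmod_prod_quaternionGroup (hm : Odd m) (hp : Even p) :
    (Module.finrank ℂ (invariantTriples (Multiplicative (ZMod m) × QuaternionGroup p)) : ℚ) =
      (1/6) * m^2 * p^2 + (1/2) * m^2 * p + (2/3) * m^2 + (3/2) * m * p + (1/6) * p^2 + m +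
        (1/2) * p + 2/3 + (m.gcd 3 + 1) * (p.gcd 3 + 1) / 12 := by
  have key := finrank_invariantTriples_mul (Multiplicative (ZMod m) × QuaternionGroup p)
  have hA : Nat.card (Multiplicative (ZMod m)) = m := Nat.card_zmod m
  have hodd : Odd (Nat.card (Multiplicative (ZMod m))) := hA.symm ▸ hm
  have hQ : Nat.card (QuaternionGroup p) = 4 * p := by
    rw [Nat.card_eq_fintype_card, QuaternionGroup.card]
  rw [relMoment_prod 2 (fun g a => g * a = a * g) (fun g a => g * a = a * g)
      fun _ _ => Prod.ext_iff,
    relMoment_prod 1 (fun g a => g * g * a = a * (g * g)) (fun g a => g * g * a = a * (g * g))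
      fun _ _ => Prod.ext_iff,
    relMoment_prod 1 (fun g a => g * g * g = a * a * a) (fun g a => g * g * g = a * a * a)
      fun _ _ => Prod.ext_iff,
    relMoment_prod 2 (fun g a => g * g = a * a) (fun g a => g * g = a * a)
      fun _ _ => Prod.ext_iff,
    relMoment_prod 1 (fun g a => g * g * g = a * a) (fun g a => g * g * g = a * a)
      fun _ _ => Prod.ext_iff,
    relMoment_comm_of_commGroup, relMoment_sq_comm_of_commGroup,
    relMoment_cube_eq_cube_of_isCyclic, relMoment_sq_eq_sq_of_odd _ hodd,
    relMoment_cube_eq_sq_of_odd _ hodd, QuaternionGroup.relMoment_sq_comm hp,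
    QuaternionGroup.relMoment_cube_eq_cube, QuaternionGroup.relMoment_cube_eq_sq, Nat.card_prod,
    hA, hQ] at key
  have hcomm := QuaternionGroup.relMoment_comm (p := p) 2
  have hsq := QuaternionGroup.relMoment_sq_eq_sq hp 2
  qify at key hcomm hsq
  rw [← eq_sub_iff_add_eq] at hcomm hsq
  rw [hcomm, hsq] at key
  have hm0 : (m : ℚ) ≠ 0 := by exact_mod_cast NeZero.ne m
  have hp0 : (p : ℚ) ≠ 0 := by exact_mod_cast NeZero.ne p
  have hmp : (12 * (m * (4 * p)) : ℚ) ≠ 0 := by positivity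
  rw [← mul_left_inj' hmp, key]
  ring

theorem finrank_invariantClassFunctions_zmod_prod_quaternionGroup (hm : Odd m) (hp : Even p) :
    (Module.finrank ℂ (invariantClassFunctions (Multiplicative (ZMod m) × QuaternionGroup p)) : ℚ) =
      (m + 1) * (p + 3) / 2 := by
  have key := finrank_invariantClassFunctions_mul (Multiplicative (ZMod m) × QuaternionGroup p)
  have hA : Nat.card (Multiplicative (ZMod m)) = m := Nat.card_zmod m
  have hodd : Odd (Nat.card (Multiplicative (ZMod m))) := hA.symm ▸ hm
  have hQ : Nat.card (QuaternionGroup p) = 4 * p := by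
    rw [Nat.card_eq_fintype_card, QuaternionGroup.card]
  rw [relMoment_prod 1 (fun g a => g * a = a * g) (fun g a => g * a = a * g)
      fun _ _ => Prod.ext_iff,
    relMoment_prod 1 (fun g a => g * g = a * a) (fun g a => g * g = a * a)
      fun _ _ => Prod.ext_iff,
    relMoment_comm_of_commGroup, relMoment_sq_eq_sq_of_odd _ hodd, Nat.card_prod, hA, hQ] at key
  have hcomm := QuaternionGroup.relMoment_comm (p := p) 1
  have hsq := QuaternionGroup.relMoment_sq_eq_sq hp 1
  qify at key hcomm hsq
  rw [← eq_sub_iff_add_eq] at hcomm hsq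
  rw [hcomm, hsq] at key
  have hm0 : (m : ℚ) ≠ 0 := by exact_mod_cast NeZero.ne m
  have hp0 : (p : ℚ) ≠ 0 := by exact_mod_cast NeZero.ne p
  have hmp : (2 * (m * (4 * p)) : ℚ) ≠ 0 := by positivity
  rw [← mul_left_inj' hmp, key]
  ring

end Product

/-- the dimension formulas for `π = (ℤ/mℤ) × D*₄ₚ`, `p` even,
`gcd(m, 2p) = 1`. -/
theorem dim_aThetaOdd_zmod_prod_binaryDihedral_even (m p : ℕ) (hm : 1 ≤ m) (hp : 0 < p)
    (hpe : Even p) (hcop : Nat.gcd m (2 * p) = 1) :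
    (¬ (3 ∣ p) → ¬ (3 ∣ m) →
      (dimAThetaOddGroupAlgebra (Multiplicative (ZMod m) × QuaternionGroup p) : ℚ)
        = (1/6) * m^2 * p^2 + (1/2) * m^2 * p + (2/3) * m^2 + (3/2) * m * p
          + (1/6) * p^2 + m + (1/2) * p + 1 ∧
      (dimAThetaOddKerAug (Multiplicative (ZMod m) × QuaternionGroup p) : ℚ)
        = (1/6) * m^2 * p^2 + (1/2) * m^2 * p + (2/3) * m^2 + m * p
          + (1/6) * p^2 - (1/2) * m - 1/2) ∧
    ((3 ∣ p ∨ 3 ∣ m) →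
      (dimAThetaOddGroupAlgebra (Multiplicative (ZMod m) × QuaternionGroup p) : ℚ)
        = (1/6) * m^2 * p^2 + (1/2) * m^2 * p + (2/3) * m^2 + (3/2) * m * p
          + (1/6) * p^2 + m + (1/2) * p + 4/3 ∧
      (dimAThetaOddKerAug (Multiplicative (ZMod m) × QuaternionGroup p) : ℚ)
        = (1/6) * m^2 * p^2 + (1/2) * m^2 * p + (2/3) * m^2 + m * p
          + (1/6) * p^2 - (1/2) * m - 1/6) := by

  have : NeZero m := ⟨by omega⟩
  have : NeZero p := ⟨by omega⟩
  have hodd : Odd m := by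
    rw [← Nat.coprime_two_right]
    exact Nat.Coprime.coprime_mul_right_right hcop
  have hmp : m.Coprime p := Nat.Coprime.coprime_mul_left_right hcop
  have hK : (dimAThetaOddKerAug (Multiplicative (ZMod m) × QuaternionGroup p) : ℚ) =
      Module.finrank ℂ (invariantTriples (Multiplicative (ZMod m) × QuaternionGroup p)) -
        (m + 1) * (p + 3) / 2 := by
    rw [← finrank_invariantClassFunctions_zmod_prod_quaternionGroup m p hodd hpe,
      ← dimAThetaOddKerAug_add]
    push_cast
    ring
  have gcd_of_not_dvd {n : ℕ} (h : ¬ 3 ∣ n) : n.gcd 3 = 1 :=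
    ((Nat.prime_three.coprime_iff_not_dvd).2 h).symm
  rw [hK, dimAThetaOddGroupAlgebra_eq,
    finrank_invariantTriples_zmod_prod_quaternionGroup m p hodd hpe]
  constructor
  · intro h3p h3m
    rw [gcd_of_not_dvd h3p, gcd_of_not_dvd h3m]
    constructor <;> push_cast <;> ring
  · intro h3
    have hgcd : ((m.gcd 3 : ℚ) + 1) * (p.gcd 3 + 1) = 8 := by
      rcases h3 with h3 | h3
      · have h3m : ¬ 3 ∣ m := fun h => Nat.not_coprime_of_dvd_of_dvd (by norm_num) h h3 hmp
        rw [Nat.gcd_eq_right h3, gcd_of_not_dvd h3m]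
        norm_num
      · have h3p : ¬ 3 ∣ p := fun h => Nat.not_coprime_of_dvd_of_dvd (by norm_num) h3 h hmp
        rw [Nat.gcd_eq_right h3, gcd_of_not_dvd h3p]
        norm_num
    rw [hgcd]
    constructor <;> ring
end
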